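/- arXiv:2002.09862 — 5 statements merged into one kernel-verified Lean document; each statement's English description precedes it below -/
import Mathlib

section
/- Under the stated Markovian switching network model, algorithm, and step-size assumptions, the agents' states reach consensus almost surely: with probability 1, for every agent i ∈ {1,…,N}, ‖x_i(k) − y(k)‖ → 0 as k → ∞, where y(k) = (1/N) Σ_{i=1}^N x_i(k). -/
open MeasureTheory Matrix Filter RealInnerProductSpace

/-- The subdifferential of `f : ℝⁿ → ℝ` at `z`:  `g ∈ ∂f(z)` iff
`f w ≥ f z + ⟪g, w − z⟫` for all `w`. -/
def subdiff {n : ℕ} (f : EuclideanSpace ℝ (Fin n) → ℝ) (z : EuclideanSpace ℝ (Fin n)) :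
    Set (EuclideanSpace ℝ (Fin n)) :=
  {g | ∀ w, f z + ⟪g, w - z⟫ ≤ f w}

/-- A nonnegative sequence that contracts by a factor `1 - γ k` up to an error `η k = o(γ k)` over
windows of length `L k ≤ γ k * (k + 1)` tends to zero. -/
theorem tendsto_zero_of_window_contraction {r γ η : ℕ → ℝ} {L : ℕ → ℕ}
    (hr : ∀ k, 0 ≤ r k) (hL : ∀ k, 1 ≤ L k)
    (hcontr : ∀ᶠ k in atTop, r (k + L k) ≤ (1 - γ k) * r k + η k)
    (hwin : ∀ᶠ k in atTop, ∀ t ≤ L k, r (k + t) ≤ r k + η k)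
    (hηγ : ∀ ε > 0, ∀ᶠ k in atTop, η k ≤ ε * γ k)
    (hη : Tendsto η atTop (nhds 0))
    (hLγ : ∀ᶠ k in atTop, (L k : ℝ) / ((k : ℝ) + 1) ≤ γ k) :
    Tendsto r atTop (nhds 0) := by
  have key : ∀ ε > 0, ∀ᶠ k in atTop, r k ≤ 3 * ε := by
    intro ε hε
    obtain ⟨K, hK⟩ := eventually_atTop.1 (hcontr.and (hwin.and ((hηγ (ε / 2) (by positivity)).and
      ((hη.eventually_le_const hε).and hLγ))))
    let κ : ℕ → ℕ := fun j => (fun s => s + L s)^[j] K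
    have κ_succ : ∀ j, κ (j + 1) = κ j + L (κ j) := fun j =>
      Function.iterate_succ_apply' (fun s => s + L s) j K
    have κ_ge : ∀ j, K + j ≤ κ j := by
      intro j
      induction j with
      | zero => exact le_refl K
      | succ j ih =>
        have h1 := hL (κ j)
        rw [κ_succ]; omega
    have γ_nonneg : ∀ k, K ≤ k → 0 ≤ γ k := fun k hk =>
      le_trans (by positivity) (hK k hk).2.2.2.2
    let H : ℕ → ℝ := fun k => ∑ s ∈ Finset.range k, 1 / ((s : ℝ) + 1)
    have H_add : ∀ k t, H (k + t) ≤ H k + t / ((k : ℝ) + 1) := by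
      intro k t
      induction t with
      | zero => simp
      | succ t ih =>
        have h1 : H (k + (t + 1)) = H (k + t) + 1 / (((k + t : ℕ) : ℝ) + 1) :=
          Finset.sum_range_succ _ _
        have h2 : 1 / (((k + t : ℕ) : ℝ) + 1) ≤ 1 / ((k : ℝ) + 1) := by
          push_cast
          gcongr
          linarith [Nat.cast_nonneg (α := ℝ) t]
        have h3 : ((t + 1 : ℕ) : ℝ) / ((k : ℝ) + 1) = t / ((k : ℝ) + 1) + 1 / ((k : ℝ) + 1) := by
          push_cast; ring
        linarith
    have decrease : ∀ k, K ≤ k → ε ≤ r k → r (k + L k) ≤ r k - ε / 2 * γ k := by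
      intro k hk hrk
      obtain ⟨h1, -, h2, -, -⟩ := hK k hk
      nlinarith [γ_nonneg k hk]
    have small : ∃ j, r (κ j) < ε := by
      by_contra! hcon
      have hbound : ∀ j, r (κ j) ≤ r K - ε / 2 * (H (κ j) - H K) := by
        intro j
        induction j with
        | zero => simp [κ]
        | succ j ih =>
          have hj : K ≤ κ j := le_trans (Nat.le_add_right _ _) (κ_ge j)
          have h1 := decrease (κ j) hj (hcon j)
          have h2 := H_add (κ j) (L (κ j))
          have h3 := (hK (κ j) hj).2.2.2.2
          rw [κ_succ]
          nlinarith
      have hκ : Tendsto κ atTop atTop :=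
        tendsto_atTop_mono (fun j => (Nat.le_add_left j K).trans (κ_ge j)) tendsto_id
      have hH : Tendsto (fun j => H (κ j)) atTop atTop :=
        Real.tendsto_sum_range_one_div_nat_succ_atTop.comp hκ
      obtain ⟨j, hj⟩ := (hH.eventually_gt_atTop (H K + 2 / ε * r K)).exists
      have h1 := hbound j
      have h2 := hcon j
      have h3 : ε / 2 * (2 / ε * r K) = r K := by field_simp
      nlinarith
    obtain ⟨j₀, hj₀⟩ := small
    have orbit : ∀ j, j₀ ≤ j → r (κ j) ≤ 2 * ε := by
      intro j hj
      induction j, hj using Nat.le_induction with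
      | base => linarith
      | succ j _ ih =>
        have hj : K ≤ κ j := le_trans (Nat.le_add_right _ _) (κ_ge j)
        rw [κ_succ]
        rcases lt_or_ge (r (κ j)) ε with h | h
        · have h1 := (hK (κ j) hj).2.1 _ le_rfl
          have h2 := (hK (κ j) hj).2.2.2.1
          linarith
        · have h1 := decrease (κ j) hj h
          nlinarith [γ_nonneg _ hj]
    have cover : ∀ s, κ j₀ ≤ s → ∃ j, j₀ ≤ j ∧ κ j ≤ s ∧ s < κ (j + 1) := by
      intro s hs
      induction s, hs using Nat.le_induction with
      | base => exact ⟨j₀, le_rfl, le_rfl, by have := hL (κ j₀); rw [κ_succ]; omega⟩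
      | succ s _ ih =>
        obtain ⟨j, hj, h1, h2⟩ := ih
        rcases Nat.lt_or_ge (s + 1) (κ (j + 1)) with h | h
        · exact ⟨j, hj, by omega, h⟩
        · exact ⟨j + 1, by omega, h, by have := hL (κ (j + 1)); rw [κ_succ (j + 1)]; omega⟩
    refine eventually_atTop.2 ⟨κ j₀, fun s hs => ?_⟩
    obtain ⟨j, hj, h1, h2⟩ := cover s hs
    have hj' : K ≤ κ j := le_trans (Nat.le_add_right _ _) (κ_ge j)
    rw [κ_succ] at h2
    obtain ⟨t, rfl⟩ := Nat.exists_eq_add_of_le h1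
    have h3 := (hK (κ j) hj').2.1 t (by omega)
    have h4 := (hK (κ j) hj').2.2.2.1
    have h5 := orbit j hj
    linarith
  rw [Metric.tendsto_nhds]
  intro ε hε
  filter_upwards [key (ε / 6) (by positivity)] with k hk
  rw [Real.dist_eq, sub_zero, abs_of_nonneg (hr k)]
  linarith

section Contraction

variable {E : Type*} [NormedAddCommGroup E] [InnerProductSpace ℝ E]

/-- A relaxed step towards a point of no larger norm decreases the norm. -/
theorem norm_sq_relaxed_step_le {z w : E} (hw : ‖w‖ ≤ ‖z‖) {a : ℝ} (ha : 0 ≤ a) :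
    ‖z + a • (w - z)‖ ^ 2 ≤ ‖z‖ ^ 2 - a * (1 - a) * ‖w - z‖ ^ 2 := by
  have h1 : ‖z + a • (w - z)‖ ^ 2 = ‖z‖ ^ 2 + 2 * (a * ⟪z, w - z⟫) + a ^ 2 * ‖w - z‖ ^ 2 := by
    rw [norm_add_sq_real, inner_smul_right, norm_smul, mul_pow, Real.norm_eq_abs, sq_abs]
  have h2 : ‖w‖ ^ 2 = ‖z‖ ^ 2 + 2 * ⟪z, w - z⟫ + ‖w - z‖ ^ 2 := by
    rw [← norm_add_sq_real, add_sub_cancel]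
  have h3 : ‖w‖ ^ 2 ≤ ‖z‖ ^ 2 := by gcongr
  nlinarith

theorem norm_relaxed_step_le {z w : E} (hw : ‖w‖ ≤ ‖z‖) {a : ℝ} (ha : 0 ≤ a) (ha1 : a ≤ 1) :
    ‖z + a • (w - z)‖ ≤ ‖z‖ := by
  refine le_of_sq_le_sq ?_ (norm_nonneg _)
  have h := norm_sq_relaxed_step_le hw ha
  have : 0 ≤ a * (1 - a) * ‖w - z‖ ^ 2 :=
    mul_nonneg (mul_nonneg ha (by linarith)) (sq_nonneg _)
  linarith

/-- The noiseless relaxed iteration driven by the maps `B t`, started from `z₀`. -/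
def relaxedOrbit (B : ℕ → E →ₗ[ℝ] E) (a : ℕ → ℝ) (z₀ : E) : ℕ → E
  | 0 => z₀
  | t + 1 => relaxedOrbit B a z₀ t + a t • (B t (relaxedOrbit B a z₀ t) - relaxedOrbit B a z₀ t)

variable {B : ℕ → E →ₗ[ℝ] E} {a : ℕ → ℝ} {z₀ : E}

theorem antitone_norm_relaxedOrbit (hB : ∀ t z, ‖B t z‖ ≤ ‖z‖) (ha : ∀ t, 0 ≤ a t)
    (ha1 : ∀ t, a t ≤ 1) : Antitone fun t => ‖relaxedOrbit B a z₀ t‖ :=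
  antitone_nat_of_succ_le fun t => norm_relaxed_step_le (hB t _) (ha t) (ha1 t)

theorem norm_relaxedOrbit_sub_le (hB : ∀ t z, ‖B t z‖ ≤ ‖z‖) (ha : ∀ t, 0 ≤ a t) {a₀ : ℝ}
    (ha0 : ∀ t, a t ≤ a₀) (ha1 : a₀ ≤ 1) (t : ℕ) :
    ‖relaxedOrbit B a z₀ t - z₀‖ ≤ t * (2 * a₀ * ‖z₀‖) := by
  induction t with
  | zero => simp [relaxedOrbit]
  | succ t ih =>
    set z := relaxedOrbit B a z₀ t with hz
    have hzz : ‖z‖ ≤ ‖z₀‖ :=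
      antitone_norm_relaxedOrbit hB ha (fun t => (ha0 t).trans ha1) (Nat.zero_le t)
    have h1 : ‖a t • (B t z - z)‖ ≤ 2 * a₀ * ‖z₀‖ := by
      rw [norm_smul, Real.norm_of_nonneg (ha t)]
      have h2 : ‖B t z - z‖ ≤ 2 * ‖z₀‖ := by
        linarith [norm_sub_le (B t z) z, hB t z]
      calc a t * ‖B t z - z‖ ≤ a₀ * (2 * ‖z₀‖) :=
            mul_le_mul (ha0 t) h2 (norm_nonneg _) ((ha t).trans (ha0 t))
        _ = 2 * a₀ * ‖z₀‖ := by ring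
    have h3 : relaxedOrbit B a z₀ (t + 1) - z₀ = (z - z₀) + a t • (B t z - z) := by
      simp only [relaxedOrbit, ← hz]; abel
    rw [h3]
    push_cast
    linarith [norm_add_le (z - z₀) (a t • (B t z - z))]

/-- If one of the maps used before time `T` moves `z₀` by a definite fraction of its norm, then the
relaxed iteration contracts. -/
theorem norm_relaxedOrbit_le_of_moves (hB : ∀ t z, ‖B t z‖ ≤ ‖z‖) (ha : ∀ t, 0 ≤ a t) {a₀ : ℝ}
    (ha0 : ∀ t, a t ≤ a₀) (ha1 : a₀ ≤ 1 / 2) {c b : ℝ} (hc : 0 < c) (hc1 : c ≤ 1) {T s : ℕ}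
    (hsT : s < T) (hs : c * ‖z₀‖ ≤ ‖B s z₀ - z₀‖) (hb : b ≤ a s) (hb0 : 0 ≤ b)
    (hT : 8 * (T * a₀) ≤ c) :
    ‖relaxedOrbit B a z₀ T‖ ≤ (1 - c ^ 2 / 16 * b) * ‖z₀‖ := by
  have ha1' : ∀ t, a t ≤ 1 := fun t => (ha0 t).trans (by linarith)
  have hanti := antitone_norm_relaxedOrbit (z₀ := z₀) hB ha ha1'
  refine (hanti (Nat.succ_le_of_lt hsT)).trans ?_
  set z := relaxedOrbit B a z₀ s with hz
  have hzz : ‖z‖ ≤ ‖z₀‖ := hanti (Nat.zero_le s)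
  have h1 : ‖z - z₀‖ ≤ s * (2 * a₀ * ‖z₀‖) :=
    norm_relaxedOrbit_sub_le hB ha ha0 (by linarith) s
  have hn := norm_nonneg z₀
  have ha00 : 0 ≤ a₀ := (ha 0).trans (ha0 0)
  have hsT' : (s : ℝ) ≤ T := by exact_mod_cast hsT.le
  have h2 : ‖z - z₀‖ ≤ c / 4 * ‖z₀‖ := by
    refine h1.trans ?_
    have : (s : ℝ) * (2 * a₀) ≤ c / 4 := by nlinarith
    nlinarith
  have h3 : c / 2 * ‖z₀‖ ≤ ‖B s z - z‖ := by
    have h4 : B s z₀ - z₀ = (B s z - z) - B s (z - z₀) + (z - z₀) := by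
      rw [map_sub]; abel
    have h5 := norm_add_le ((B s z - z) - B s (z - z₀)) (z - z₀)
    have h6 := norm_sub_le (B s z - z) (B s (z - z₀))
    have h7 := hB s (z - z₀)
    rw [← h4] at h5
    linarith
  have h4 := norm_sq_relaxed_step_le (hB s z) (ha s)
  have h5 : (c / 2 * ‖z₀‖) ^ 2 ≤ ‖B s z - z‖ ^ 2 := by gcongr
  have h6 : b / 2 ≤ a s * (1 - a s) := by nlinarith [ha0 s, ha s]
  have h7 : b / 2 * (c / 2 * ‖z₀‖) ^ 2 ≤ a s * (1 - a s) * ‖B s z - z‖ ^ 2 :=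
    mul_le_mul h6 h5 (sq_nonneg _) (by linarith)
  have h8 : ‖z‖ ^ 2 ≤ ‖z₀‖ ^ 2 := by gcongr
  have hcb : c ^ 2 / 16 * b ≤ 1 := by
    have : b ≤ 1 := hb.trans (ha1' s)
    nlinarith
  change ‖z + a s • (B s z - z)‖ ≤ _
  refine le_of_sq_le_sq ?_ (mul_nonneg (by linarith) hn)
  nlinarith [sq_nonneg (c ^ 2 / 16 * b * ‖z₀‖)]

/-- Consensus along a single trajectory: if every map moves the state visibly often enough, compared
with the step sizes, then the perturbed relaxed iteration converges to zero. -/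
theorem tendsto_zero_of_perturbed_relaxed_iteration {ι : Type*} {B : ι → E →ₗ[ℝ] E}
    (hB : ∀ j z, ‖B j z‖ ≤ ‖z‖) {θ : ℕ → ι} {e u : ℕ → E} {α β : ℕ → ℝ} {L : ℕ → ℕ} {c C : ℝ}
    (hstep : ∀ k, e (k + 1) = e k + α k • (B (θ k) (e k) - e k) + β k • u k)
    (hu : ∀ k, ‖u k‖ ≤ C) (hc : 0 < c) (hc1 : c ≤ 1)
    (hmove : ∀ k, ∃ j, c * ‖e k‖ ≤ ‖B j (e k) - e k‖)
    (hα : Antitone α) (hα0 : ∀ k, 0 < α k) (hβ : Antitone β) (hβ0 : ∀ k, 0 ≤ β k)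
    (hL : ∀ k, 1 ≤ L k) (hα2 : ∀ᶠ k in atTop, α k ≤ 2 * α (k + L k))
    (hLα : Tendsto (fun k => L k * α k) atTop (nhds 0))
    (hLβ : Tendsto (fun k => L k * β k / α k) atTop (nhds 0))
    (hLk : Tendsto (fun k : ℕ => L k / (((k : ℝ) + 1) * α k)) atTop (nhds 0))
    (hvisit : ∀ᶠ k in atTop, ∀ j, ∃ t < L k, θ (k + t) = j) :
    Tendsto e atTop (nhds 0) := by
  rw [tendsto_zero_iff_norm_tendsto_zero]
  have hC : 0 ≤ C := (norm_nonneg _).trans (hu 0)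
  have hαlim : ∀ ε > 0, ∀ᶠ k in atTop, α k ≤ ε := by
    intro ε hε
    filter_upwards [hLα.eventually_le_const hε] with k hk
    have : (1 : ℝ) ≤ L k := by exact_mod_cast hL k
    nlinarith [hα0 k]
  have orbit_close : ∀ k, α k ≤ 1 → ∀ t,
      ‖e (k + t) - relaxedOrbit (fun t => B (θ (k + t))) (fun t => α (k + t)) (e k) t‖
        ≤ t * (C * β k) := by
    intro k hk t
    induction t with
    | zero => simp [relaxedOrbit]
    | succ t ih =>
      set z := relaxedOrbit (fun t => B (θ (k + t))) (fun t => α (k + t)) (e k) t with hz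
      have h1 : e (k + (t + 1)) - relaxedOrbit (fun t => B (θ (k + t))) (fun t => α (k + t)) (e k)
          (t + 1) = ((e (k + t) - z) + α (k + t) • (B (θ (k + t)) (e (k + t) - z)
            - (e (k + t) - z))) + β (k + t) • u (k + t) := by
        rw [← add_assoc, hstep]
        simp only [relaxedOrbit, ← hz, map_sub]
        module
      have h2 := norm_relaxed_step_le (hB (θ (k + t)) (e (k + t) - z)) (hα0 (k + t)).le
        ((hα (Nat.le_add_right k t)).trans hk)
      have h3 : ‖β (k + t) • u (k + t)‖ ≤ C * β k := by
        rw [norm_smul, Real.norm_of_nonneg (hβ0 _), mul_comm C]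
        exact mul_le_mul (hβ (Nat.le_add_right k t)) (hu _) (norm_nonneg _) (hβ0 _)
      rw [h1]
      push_cast
      linarith [norm_add_le ((e (k + t) - z) + α (k + t) • (B (θ (k + t)) (e (k + t) - z)
            - (e (k + t) - z))) (β (k + t) • u (k + t))]
  have hηγ : ∀ ε > 0, ∀ᶠ k in atTop, L k * (C * β k) ≤ ε * α k := by
    intro ε hε
    have h1 : Tendsto (fun k => C * (L k * β k / α k)) atTop (nhds 0) := by
      simpa using hLβ.const_mul C
    filter_upwards [h1.eventually_le_const hε] with k hk
    have h2 := mul_le_mul_of_nonneg_right hk (hα0 k).le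
    have h3 : C * (L k * β k / α k) * α k = L k * (C * β k) := by
      have := (hα0 k).ne'
      field_simp
    linarith
  refine tendsto_zero_of_window_contraction (γ := fun k => c ^ 2 / 32 * α k)
    (η := fun k => L k * (C * β k)) (L := L) (fun k => norm_nonneg _) hL ?_ ?_ ?_ ?_ ?_
  · filter_upwards [hαlim (1 / 2) (by norm_num), hα2, hvisit,
      hLα.eventually_le_const (show 0 < c / 8 by positivity)] with k h1 h2 h3 h4
    obtain ⟨j, hj⟩ := hmove k
    obtain ⟨s, hs, rfl⟩ := h3 j
    have h5 := norm_relaxedOrbit_le_of_moves (B := fun t => B (θ (k + t)))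
      (a := fun t => α (k + t)) (z₀ := e k) (a₀ := α k) (b := α (k + L k)) (fun t => hB _)
      (fun t => (hα0 _).le) (fun t => hα (Nat.le_add_right k t)) h1 hc hc1 hs hj
      (hα (by omega)) (hα0 _).le (by linarith)
    have h6 := orbit_close k (by linarith) (L k)
    have h7 := norm_le_insert' (e (k + L k))
      (relaxedOrbit (fun t => B (θ (k + t))) (fun t => α (k + t)) (e k) (L k))
    have h8 : c ^ 2 / 32 * α k ≤ c ^ 2 / 16 * α (k + L k) := by nlinarith [sq_nonneg c]
    nlinarith [norm_nonneg (e k)]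
  · filter_upwards [hαlim 1 one_pos] with k h1 t ht
    have h6 := orbit_close k h1 t
    have h7 := norm_le_insert' (e (k + t))
      (relaxedOrbit (fun t => B (θ (k + t))) (fun t => α (k + t)) (e k) t)
    have h5 : ‖relaxedOrbit (fun t => B (θ (k + t))) (fun t => α (k + t)) (e k) t‖ ≤ ‖e k‖ :=
      antitone_norm_relaxedOrbit (fun t => hB _) (fun t => (hα0 _).le)
        (fun t => (hα (Nat.le_add_right k t)).trans h1) (Nat.zero_le t)
    have h8 : (t : ℝ) * (C * β k) ≤ L k * (C * β k) := by
      have := hβ0 k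
      gcongr
    linarith
  · intro ε hε
    filter_upwards [hηγ (ε * (c ^ 2 / 32)) (by positivity)] with k hk
    linarith
  · rw [Metric.tendsto_nhds]
    intro ε hε
    filter_upwards [hηγ (ε / 2) (by positivity), hαlim 1 one_pos] with k h1 h2
    have := hβ0 k
    rw [Real.dist_eq, sub_zero, abs_of_nonneg (by positivity)]
    nlinarith
  · filter_upwards [hLk.eventually_le_const (show 0 < c ^ 2 / 32 by positivity)] with k hk
    rw [← div_div, div_le_iff₀ (hα0 k)] at hk
    exact hk

end Contraction

section DoublyStochastic

variable {ι : Type*} [Fintype ι]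

/-- A function that is harmonic for stochastic matrices with strongly connected union graph is
constant. -/
theorem eq_of_mulVec_eq_self {κ : Type*} {A : κ → Matrix ι ι ℝ} (hA : ∀ l i j, 0 ≤ A l i j)
    (hrow : ∀ l i, ∑ j, A l i j = 1)
    (hconn : ∀ i j, Relation.ReflTransGen (fun u v => ∃ l, 0 < A l v u) i j)
    {z : ι → ℝ} (hz : ∀ l, A l *ᵥ z = z) (i j : ι) : z i = z j := by
  have : Nonempty ι := ⟨i⟩
  obtain ⟨M, hM⟩ := Finite.exists_max z
  have back : ∀ u, z u = z M := by
    intro u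
    induction hconn u M using Relation.ReflTransGen.head_induction_on with
    | refl => rfl
    | @head u v huv _ ih =>
      obtain ⟨l, hl⟩ := huv
      refine le_antisymm (hM u) (le_of_not_gt fun hlt => ?_)
      have h1 : ∑ j, A l v j * z j < ∑ j, A l v j * z M :=
        Finset.sum_lt_sum (fun j _ => mul_le_mul_of_nonneg_left (hM j) (hA l v j))
          ⟨u, Finset.mem_univ u, mul_lt_mul_of_pos_left hlt hl⟩
      rw [← Finset.sum_mul, hrow, one_mul, ← ih] at h1
      exact h1.ne (congrFun (hz l) v)
  rw [back i, back j]

variable [DecidableEq ι]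

/-- A doubly stochastic matrix is a contraction for the Euclidean norm. -/
theorem norm_toEuclideanLin_le_of_doublyStochastic {A : Matrix ι ι ℝ} (hA : ∀ i j, 0 ≤ A i j)
    (hrow : ∀ i, ∑ j, A i j = 1) (hcol : ∀ j, ∑ i, A i j = 1) (z : EuclideanSpace ℝ ι) :
    ‖toEuclideanLin A z‖ ≤ ‖z‖ := by
  refine le_of_sq_le_sq ?_ (norm_nonneg _)
  rw [EuclideanSpace.real_norm_sq_eq, EuclideanSpace.real_norm_sq_eq]
  have h1 : ∀ i, (toEuclideanLin A z i) ^ 2 ≤ ∑ j, A i j * z j ^ 2 := by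
    intro i
    have := (even_two.convexOn_pow (𝕜 := ℝ)).map_sum_le (t := Finset.univ) (w := A i)
      (p := fun j => z j) (fun j _ => hA i j) (hrow i) (fun _ _ => Set.mem_univ _)
    simpa [toLpLin_apply, mulVec, dotProduct] using this
  calc ∑ i, (toEuclideanLin A z i) ^ 2 ≤ ∑ i, ∑ j, A i j * z j ^ 2 :=
        Finset.sum_le_sum fun i _ => h1 i
    _ = ∑ j, z j ^ 2 := by
        rw [Finset.sum_comm]
        simp_rw [← Finset.sum_mul, hcol, one_mul]

/-- On mean-zero vectors, at least one of finitely many stochastic matrices with strongly connected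
union graph is uniformly far from the identity. -/
theorem exists_le_norm_toEuclideanLin_sub {κ : Type*} [Fintype κ] [Nonempty κ]
    {A : κ → Matrix ι ι ℝ} (hA : ∀ l i j, 0 ≤ A l i j) (hrow : ∀ l i, ∑ j, A l i j = 1)
    (hconn : ∀ i j, Relation.ReflTransGen (fun u v => ∃ l, 0 < A l v u) i j) :
    ∃ c : ℝ, 0 < c ∧ c ≤ 1 ∧ ∀ z : EuclideanSpace ℝ ι, ∑ i, z i = 0 →
      ∃ l, c * ‖z‖ ≤ ‖toEuclideanLin (A l) z - z‖ := by
  let S : EuclideanSpace ℝ ι →ₗ[ℝ] ℝ :=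
    { toFun := fun z => ∑ i, z i
      map_add' := fun a b => by simp [Finset.sum_add_distrib]
      map_smul' := fun a b => by simp [Finset.mul_sum] }
  let D : EuclideanSpace ℝ ι →ₗ[ℝ] (κ → EuclideanSpace ℝ ι) × ℝ :=
    (LinearMap.pi fun l => toEuclideanLin (A l) - LinearMap.id).prod S
  have hker : D.ker = ⊥ := by
    refine (Submodule.eq_bot_iff _).2 fun z hz => ?_
    have hz' : D z = 0 := hz
    have hfix : ∀ l, A l *ᵥ z.ofLp = z.ofLp := by
      intro l
      have h1 : toEuclideanLin (A l) z - z = 0 := congrFun (congrArg Prod.fst hz') l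
      rw [sub_eq_zero, toLpLin_apply] at h1
      exact congrArg WithLp.ofLp h1
    have hsum : ∑ i, z i = 0 := congrArg Prod.snd hz'
    ext i
    have h2 : ∑ j, z j = Fintype.card ι * z i := by
      rw [Finset.sum_congr rfl fun j _ => eq_of_mulVec_eq_self hA hrow hconn hfix j i]
      simp
    have : Nonempty ι := ⟨i⟩
    rw [hsum] at h2
    simpa using h2.symm
  obtain ⟨K, hK, hanti⟩ := D.exists_antilipschitzWith hker
  have hK' : (0 : ℝ) < K := hK
  refine ⟨min 1 ((K : ℝ)⁻¹), by positivity, min_le_left _ _, fun z hz => ?_⟩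
  obtain ⟨l, hl⟩ := Finite.exists_max fun l => ‖toEuclideanLin (A l) z - z‖
  refine ⟨l, ?_⟩
  have h1 : ‖z‖ ≤ K * ‖D z‖ := by simpa using hanti.le_mul_dist z 0
  have h2 : ‖D z‖ ≤ ‖toEuclideanLin (A l) z - z‖ := by
    refine max_le ((pi_norm_le_iff_of_nonneg (norm_nonneg _)).2 fun l' => hl l') ?_
    change ‖∑ i, z i‖ ≤ _
    rw [hz, norm_zero]
    exact norm_nonneg _
  calc min 1 ((K : ℝ)⁻¹) * ‖z‖ ≤ (K : ℝ)⁻¹ * (K * ‖D z‖) := by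
        gcongr
        exact min_le_right _ _
    _ = ‖D z‖ := by field_simp
    _ ≤ _ := h2

end DoublyStochastic

section MarkovChain

variable {Ω S : Type*} {m0 : MeasurableSpace Ω} {μ : Measure Ω} [IsProbabilityMeasure μ]
  {𝓕 : Filtration ℕ m0} [MeasurableSpace S]
  [MeasurableSingletonClass S] {P : Matrix S S ℝ} {θ : ℕ → Ω → S}

theorem measureReal_inter_markov_step (hθ : ∀ k, Measurable[𝓕 k] (θ k))
    (hmarkov : ∀ k j, μ[Set.indicator {ω | θ (k + 1) ω = j} (fun _ => (1 : ℝ))|𝓕 k]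
      =ᵐ[μ] fun ω => P (θ k ω) j)
    {k : ℕ} {i : S} {F : Set Ω} (hF : MeasurableSet[𝓕 k] F) (hFi : ∀ ω ∈ F, θ k ω = i) (j : S) :
    μ.real (F ∩ {ω | θ (k + 1) ω = j}) = P i j * μ.real F := by
  have hj : MeasurableSet {ω | θ (k + 1) ω = j} :=
    𝓕.le (k + 1) _ (hθ (k + 1) (measurableSet_singleton j))
  have hF' : MeasurableSet F := 𝓕.le k _ hF
  have h1 := setIntegral_condExp (𝓕.le k) (μ := μ)
    ((integrable_const (1 : ℝ)).indicator hj) hF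
  rw [setIntegral_indicator hj, setIntegral_const, smul_eq_mul, mul_one] at h1
  rw [← h1, setIntegral_congr_ae (g := fun _ => P i j) hF', setIntegral_const, smul_eq_mul,
    mul_comm]
  filter_upwards [hmarkov k j] with ω hω hωF
  rw [hω, hFi ω hωF]

variable [Fintype S]

theorem measureReal_eq_sum_inter_fiber {X : Ω → S} (hX : Measurable X) {F : Set Ω}
    (hF : MeasurableSet F) : μ.real F = ∑ i, μ.real (F ∩ {ω | X ω = i}) := by
  rw [← measureReal_iUnion_fintype (f := fun i => F ∩ {ω | X ω = i})]
  · congr 1; ext ω; simp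
  · intro i j hij
    refine Set.disjoint_left.2 fun ω h1 h2 => hij ?_
    rw [← h1.2, ← h2.2]
  · exact fun i => hF.inter (hX (measurableSet_singleton i))

variable [DecidableEq S]

theorem measureReal_inter_markov_pow (hθ : ∀ k, Measurable[𝓕 k] (θ k))
    (hmarkov : ∀ k j, μ[Set.indicator {ω | θ (k + 1) ω = j} (fun _ => (1 : ℝ))|𝓕 k]
      =ᵐ[μ] fun ω => P (θ k ω) j)
    {k : ℕ} {i : S} {F : Set Ω} (hF : MeasurableSet[𝓕 k] F) (hFi : ∀ ω ∈ F, θ k ω = i) (q : ℕ)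
    (j : S) : μ.real (F ∩ {ω | θ (k + q) ω = j}) = (P ^ q) i j * μ.real F := by
  induction q generalizing j with
  | zero =>
    rw [pow_zero, add_zero, one_apply]
    split_ifs with h
    · rw [one_mul]
      exact congrArg μ.real (Set.inter_eq_left.2 fun ω hω => (hFi ω hω).trans h)
    · rw [zero_mul, Set.disjoint_iff_inter_eq_empty.1, measureReal_empty]
      exact Set.disjoint_left.2 fun ω h1 h2 => h ((hFi ω h1).symm.trans h2)
  | succ q ih =>
    have hmeas : ∀ h, MeasurableSet[𝓕 (k + q)] {ω | θ (k + q) ω = h} := fun h =>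
      hθ (k + q) (measurableSet_singleton h)
    have hFq : MeasurableSet[𝓕 (k + q)] F := 𝓕.mono (Nat.le_add_right k q) _ hF
    have hj : MeasurableSet {ω | θ (k + (q + 1)) ω = j} :=
      𝓕.le _ _ (hθ (k + (q + 1)) (measurableSet_singleton j))
    rw [measureReal_eq_sum_inter_fiber ((hθ (k + q)).mono (𝓕.le _) le_rfl)
      ((𝓕.le _ _ hF).inter hj), pow_succ, mul_apply, Finset.sum_mul]
    refine Finset.sum_congr rfl fun h _ => ?_
    rw [Set.inter_right_comm, ← add_assoc, measureReal_inter_markov_step hθ hmarkov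
      (hFq.inter (hmeas h)) (fun ω hω => hω.2), ih]
    ring

/-- The probability of avoiding a state for `b` consecutive blocks decays geometrically in `b`. -/
theorem measureReal_avoid_le (hθ : ∀ k, Measurable[𝓕 k] (θ k))
    (hmarkov : ∀ k j, μ[Set.indicator {ω | θ (k + 1) ω = j} (fun _ => (1 : ℝ))|𝓕 k]
      =ᵐ[μ] fun ω => P (θ k ω) j)
    {j : S} {q : S → ℕ} {T : ℕ} {p : ℝ} (hq1 : ∀ i, 1 ≤ q i) (hqT : ∀ i, q i ≤ T)
    (hp : ∀ i, p ≤ (P ^ q i) i j) (hp1 : p ≤ 1) (k b : ℕ) :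
    μ.real {ω | ∀ t, 1 ≤ t → t ≤ b * T → θ (k + t) ω ≠ j} ≤ (1 - p) ^ b := by
  induction b with
  | zero => rw [pow_zero]; exact measureReal_le_one
  | succ b ih =>
    set D : Set Ω := {ω | ∀ t, 1 ≤ t → t ≤ b * T → θ (k + t) ω ≠ j} with hD
    have hDmeas : MeasurableSet[𝓕 (k + b * T)] D := by
      have h1 : D = ⋂ t, ⋂ _ : 1 ≤ t, ⋂ _ : t ≤ b * T, {ω | θ (k + t) ω = j}ᶜ := by
        ext ω; simp [hD]
      rw [h1]
      refine MeasurableSet.iInter fun t => MeasurableSet.iInter fun _ =>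
        MeasurableSet.iInter fun ht => MeasurableSet.compl ?_
      exact 𝓕.mono (by omega) _ (hθ (k + t) (measurableSet_singleton j))
    have hfib : ∀ i, MeasurableSet[𝓕 (k + b * T)] (D ∩ {ω | θ (k + b * T) ω = i}) := fun i =>
      hDmeas.inter (hθ (k + b * T) (measurableSet_singleton i))
    have hX : Measurable (θ (k + b * T)) := (hθ _).mono (𝓕.le _) le_rfl
    have hset : {ω | ∀ t, 1 ≤ t → t ≤ (b + 1) * T → θ (k + t) ω ≠ j} ⊆
        ⋃ i, (D ∩ {ω | θ (k + b * T) ω = i}) \ {ω | θ (k + b * T + q i) ω = j} := by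
      intro ω hω
      refine Set.mem_iUnion.2 ⟨θ (k + b * T) ω, ⟨⟨fun t h1 h2 => hω t h1 (by nlinarith), rfl⟩, ?_⟩⟩
      have h1 := hq1 (θ (k + b * T) ω)
      have h2 := hqT (θ (k + b * T) ω)
      have h3 := hω (b * T + q (θ (k + b * T) ω)) (by omega) (by rw [add_one_mul]; omega)
      rw [← add_assoc] at h3
      exact h3
    have hpiece : ∀ i, μ.real ((D ∩ {ω | θ (k + b * T) ω = i}) \
        {ω | θ (k + b * T + q i) ω = j}) ≤ (1 - p) * μ.real (D ∩ {ω | θ (k + b * T) ω = i}) := by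
      intro i
      have h1 : MeasurableSet {ω | θ (k + b * T + q i) ω = j} :=
        𝓕.le _ _ (hθ (k + b * T + q i) (measurableSet_singleton j))
      have h2 := measureReal_inter_add_sdiff (μ := μ)
        (s := D ∩ {ω | θ (k + b * T) ω = i}) h1
      rw [measureReal_inter_markov_pow hθ hmarkov (hfib i) (fun ω hω => hω.2)] at h2
      have h3 := mul_le_mul_of_nonneg_right (hp i)
        (measureReal_nonneg (μ := μ) (s := D ∩ {ω | θ (k + b * T) ω = i}))
      linarith
    calc _ ≤ μ.real (⋃ i, (D ∩ {ω | θ (k + b * T) ω = i}) \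
          {ω | θ (k + b * T + q i) ω = j}) := measureReal_mono hset
      _ ≤ ∑ i, μ.real ((D ∩ {ω | θ (k + b * T) ω = i}) \
          {ω | θ (k + b * T + q i) ω = j}) := measureReal_iUnion_fintype_le _
      _ ≤ ∑ i, (1 - p) * μ.real (D ∩ {ω | θ (k + b * T) ω = i}) :=
          Finset.sum_le_sum fun i _ => hpiece i
      _ = (1 - p) * μ.real D := by
          rw [← Finset.mul_sum, ← measureReal_eq_sum_inter_fiber hX (𝓕.le _ _ hDmeas)]
      _ ≤ (1 - p) ^ (b + 1) := by
          rw [pow_succ']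
          exact mul_le_mul_of_nonneg_left ih (by linarith)

/-- Almost surely, an irreducible finite chain eventually visits every state in each window starting
at `k` whose length is a suitable multiple of `log (k + 1)`. -/
theorem exists_log_window_visits (hθ : ∀ k, Measurable[𝓕 k] (θ k))
    (hmarkov : ∀ k j, μ[Set.indicator {ω | θ (k + 1) ω = j} (fun _ => (1 : ℝ))|𝓕 k]
      =ᵐ[μ] fun ω => P (θ k ω) j)
    (hirr : ∀ i j, ∃ q : ℕ, 1 ≤ q ∧ 0 < (P ^ q) i j) :
    ∃ (L : ℕ → ℕ) (R : ℝ), (∀ k, 1 ≤ L k) ∧ (∀ k : ℕ, (L k : ℝ) ≤ R * (Real.log (k + 1) + 1)) ∧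
      ∀ᵐ ω ∂μ, ∀ᶠ k in atTop, ∀ j, ∃ t < L k, θ (k + t) ω = j := by
  choose q hq1 hqpos using hirr
  obtain ⟨ω₀⟩ : Nonempty Ω := μ.nonempty_of_neZero
  have : Nonempty S := ⟨θ 0 ω₀⟩
  obtain ⟨x₁, hx₁⟩ := Finite.exists_max fun x : S × S => q x.1 x.2
  obtain ⟨x₂, hx₂⟩ := Finite.exists_min fun x : S × S => (P ^ q x.1 x.2) x.1 x.2
  set T : ℕ := q x₁.1 x₁.2 with hT
  obtain ⟨p, hp0, hp1, hp⟩ : ∃ p : ℝ, 0 < p ∧ p ≤ 1 ∧ ∀ i j, p ≤ (P ^ q i j) i j :=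
    ⟨min 1 ((P ^ q x₂.1 x₂.2) x₂.1 x₂.2), lt_min one_pos (hqpos _ _), min_le_left _ _,
      fun i j => (min_le_right _ _).trans (hx₂ (i, j))⟩
  let b : ℕ → ℕ := fun k => ⌈2 / p * Real.log (k + 1)⌉₊
  have hlog : ∀ k : ℕ, 0 ≤ Real.log ((k : ℝ) + 1) := fun k =>
    Real.log_nonneg (by linarith [Nat.cast_nonneg (α := ℝ) k])
  refine ⟨fun k => b k * T + 1, (2 / p + 1) * T + 1, fun k => Nat.le_add_left _ _, fun k => ?_, ?_⟩
  · have h1 : (b k : ℝ) ≤ 2 / p * Real.log (k + 1) + 1 :=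
      (Nat.ceil_lt_add_one (mul_nonneg (by positivity) (hlog k))).le
    have h2 : (b k : ℝ) ≤ (2 / p + 1) * (Real.log (k + 1) + 1) := by
      have : 0 ≤ 2 / p := by positivity
      nlinarith [hlog k]
    have h3 := mul_le_mul_of_nonneg_right h2 (Nat.cast_nonneg (α := ℝ) T)
    push_cast
    nlinarith [hlog k]
  · have hae : ∀ j, ∀ᵐ ω ∂μ, ∀ᶠ k in atTop,
        ω ∉ {ω | ∀ t, 1 ≤ t → t ≤ b k * T → θ (k + t) ω ≠ j} := by
      intro j
      refine ae_eventually_notMem ?_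
      have hbound : ∀ k, μ.real {ω | ∀ t, 1 ≤ t → t ≤ b k * T → θ (k + t) ω ≠ j} ≤
          1 / ((k : ℝ) + 1) ^ 2 := by
        intro k
        refine (measureReal_avoid_le hθ hmarkov (fun i => hq1 i j) (fun i => hx₁ (i, j))
          (fun i => hp i j) hp1 k (b k)).trans ?_
        have hk : (0 : ℝ) < (k : ℝ) + 1 := by positivity
        calc (1 - p) ^ b k ≤ Real.exp (-p) ^ b k :=
              pow_le_pow_left₀ (by linarith) (Real.one_sub_le_exp_neg p) _
          _ = Real.exp (-(p * b k)) := by rw [← Real.exp_nat_mul]; ring_nf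
          _ ≤ Real.exp (-(2 * Real.log (k + 1))) := by
              refine Real.exp_le_exp.2 (neg_le_neg ?_)
              have h1 := mul_le_mul_of_nonneg_left (Nat.le_ceil (2 / p * Real.log (k + 1))) hp0.le
              have h2 : p * (2 / p * Real.log (k + 1)) = 2 * Real.log (k + 1) := by field_simp
              linarith
          _ = 1 / ((k : ℝ) + 1) ^ 2 := by
              rw [Real.exp_neg, two_mul, Real.exp_add, Real.exp_log hk, one_div, sq]
      have hsum : Summable fun k : ℕ => 1 / ((k : ℝ) + 1) ^ 2 := by
        have := (summable_nat_add_iff 1).2 (Real.summable_one_div_nat_pow.2 one_lt_two)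
        simpa using this
      have h1 : Summable fun k => μ.real {ω | ∀ t, 1 ≤ t → t ≤ b k * T → θ (k + t) ω ≠ j} :=
        Summable.of_nonneg_of_le (fun _ => measureReal_nonneg) hbound hsum
      have h2 := h1.tsum_ofReal_ne_top
      simpa [measureReal_def, ENNReal.ofReal_toReal] using h2
    filter_upwards [ae_all_iff.2 hae] with ω hω
    filter_upwards [eventually_all.2 hω] with k hk j
    have h1 := hk j
    simp only [not_forall, not_not] at h1
    obtain ⟨t, -, ht, h⟩ := h1
    exact ⟨t, Nat.lt_succ_of_le ht, h⟩

end MarkovChain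

theorem tendsto_div_rpow_of_le_log {L : ℕ → ℕ} {R : ℝ}
    (hL : ∀ k : ℕ, (L k : ℝ) ≤ R * (Real.log (k + 1) + 1)) {s : ℝ} (hs : 0 < s) :
    Tendsto (fun k : ℕ => (L k : ℝ) / ((k : ℝ) + 1) ^ s) atTop (nhds 0) := by
  have hk : Tendsto (fun k : ℕ => (k : ℝ) + 1) atTop atTop :=
    tendsto_atTop_add_const_right _ _ tendsto_natCast_atTop_atTop
  have h1 : Tendsto (fun t : ℝ => R * (Real.log t / t ^ s + (t ^ s)⁻¹)) atTop (nhds 0) := by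
    simpa using ((isLittleO_log_rpow_atTop hs).tendsto_div_nhds_zero.add
      (tendsto_rpow_atTop hs).inv_tendsto_atTop).const_mul R
  refine squeeze_zero (fun k => by positivity) (fun k => ?_) (h1.comp hk)
  have h2 : (0 : ℝ) < ((k : ℝ) + 1) ^ s := by positivity
  calc (L k : ℝ) / ((k : ℝ) + 1) ^ s ≤ R * (Real.log (k + 1) + 1) / ((k : ℝ) + 1) ^ s := by
        gcongr
        exact hL k
    _ = R * (Real.log (k + 1) / ((k : ℝ) + 1) ^ s + (((k : ℝ) + 1) ^ s)⁻¹) := by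
        field_simp

theorem antitone_div_rpow {a δ : ℝ} (ha : 0 < a) (hδ : 0 < δ) :
    Antitone fun k : ℕ => a / ((k : ℝ) + 1) ^ δ := by
  intro j k hjk
  have : (j : ℝ) ≤ k := by exact_mod_cast hjk
  dsimp only
  gcongr

theorem div_rpow_le_two_mul_of_le {a δ : ℝ} (ha : 0 < a) (hδ : 0 < δ) (hδ1 : δ ≤ 1) {k t : ℕ}
    (ht : t ≤ k + 1) : a / ((k : ℝ) + 1) ^ δ ≤ 2 * (a / (((k + t : ℕ) : ℝ) + 1) ^ δ) := by
  have ht' : (t : ℝ) ≤ (k : ℝ) + 1 := by exact_mod_cast ht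
  have h1 : (((k + t : ℕ) : ℝ) + 1) ^ δ ≤ 2 * ((k : ℝ) + 1) ^ δ := by
    calc (((k + t : ℕ) : ℝ) + 1) ^ δ ≤ (2 * ((k : ℝ) + 1)) ^ δ := by
          refine Real.rpow_le_rpow (by positivity) ?_ hδ.le
          push_cast
          linarith
      _ = 2 ^ δ * ((k : ℝ) + 1) ^ δ := Real.mul_rpow (by norm_num) (by positivity)
      _ ≤ 2 * ((k : ℝ) + 1) ^ δ := by
          gcongr
          simpa using Real.rpow_le_rpow_of_exponent_le one_le_two hδ1
  have h2 : (0 : ℝ) < ((k : ℝ) + 1) ^ δ := by positivity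
  have h3 : (0 : ℝ) < (((k + t : ℕ) : ℝ) + 1) ^ δ := by positivity
  rw [← mul_div_assoc, div_le_div_iff₀ h2 h3]
  nlinarith

/-- The deviations from the average of a scalar consensus iteration with doubly stochastic weights
follow the same iteration. -/
theorem consensus_error_step {N : ℕ} {A : Matrix (Fin N) (Fin N) ℝ}
    (hrow : ∀ i, ∑ j, A i j = 1) (hcol : ∀ j, ∑ i, A i j = 1) {a b : ℝ} {v w g : Fin N → ℝ}
    (hw : ∀ i, w i = v i + a * ∑ j, A i j * (v j - v i) - b * g i) (i : Fin N) :
    w i - (N : ℝ)⁻¹ * ∑ j, w j =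
      (v i - (N : ℝ)⁻¹ * ∑ j, v j) +
        a * ((A *ᵥ fun j => v j - (N : ℝ)⁻¹ * ∑ j, v j) i - (v i - (N : ℝ)⁻¹ * ∑ j, v j)) +
        b * ((N : ℝ)⁻¹ * ∑ j, g j - g i) := by
  have h1 : ∀ i, ∑ j, A i j * (v j - v i) = ∑ j, A i j * v j - v i := by
    intro i
    simp_rw [mul_sub]
    rw [Finset.sum_sub_distrib, ← Finset.sum_mul, hrow, one_mul]
  have h2 : ∑ i, ∑ j, A i j * v j = ∑ j, v j := by
    rw [Finset.sum_comm]
    simp_rw [← Finset.sum_mul, hcol, one_mul]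
  have h3 : ∑ j, w j = ∑ j, v j - b * ∑ j, g j := by
    simp_rw [hw, h1]
    rw [Finset.sum_sub_distrib, Finset.sum_add_distrib, ← Finset.mul_sum, Finset.sum_sub_distrib,
      h2, ← Finset.mul_sum]
    ring
  have h4 : (A *ᵥ fun j => v j - (N : ℝ)⁻¹ * ∑ j, v j) i =
      ∑ j, A i j * v j - (N : ℝ)⁻¹ * ∑ j, v j := by
    simp only [mulVec, dotProduct, mul_sub]
    rw [Finset.sum_sub_distrib, ← Finset.sum_mul, hrow, one_mul]
  rw [h3, h4, hw, h1]
  ring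

/-- **Almost sure consensus.** Under the Markovian switching network model, the
consensus subgradient algorithm, and the step-size assumptions, with probability 1, for every
agent `i`, `‖x_i(k) − y(k)‖ → 0` as `k → ∞`, where `y(k) = (1/N) Σ_i x_i(k)`. -/
theorem stmt0 {Ω : Type*} {m0 : MeasurableSpace Ω} (ℙ : Measure Ω)
    [IsProbabilityMeasure ℙ] (𝓕 : Filtration ℕ m0)
    -- the Markovian switching communication network
    (m : ℕ) (hm : 1 ≤ m)
    (P : Matrix (Fin m) (Fin m) ℝ)
    (hP_nonneg : ∀ i j, 0 ≤ P i j)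
    (hP_row : ∀ i, ∑ j, P i j = 1)
    (hP_irr : ∀ i j, ∃ q : ℕ, 1 ≤ q ∧ 0 < (P ^ q) i j)
    (θ : ℕ → Ω → Fin m)
    (hθ_adapt : ∀ k, Measurable[𝓕 k] (θ k))
    (hθ_markov : ∀ k (j : Fin m),
      ℙ[Set.indicator {ω | θ (k + 1) ω = j} (fun _ => (1 : ℝ))|𝓕 k]
        =ᵐ[ℙ] fun ω => P (θ k ω) j)
    (N : ℕ) (hN : 2 ≤ N)
    (A : Fin m → Matrix (Fin N) (Fin N) ℝ)
    (hA_nonneg : ∀ l i j, 0 ≤ A l i j)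
    (hA_row : ∀ l i, ∑ j, A l i j = 1)
    (hA_col : ∀ l j, ∑ i, A l i j = 1)
    (hconn : ∀ i j : Fin N,
      Relation.ReflTransGen (fun u v : Fin N => ∃ l, 0 < A l v u) i j)
    -- the two time-scale step sizes
    (a₁ a₂ δ₁ δ₂ : ℝ) (ha₁ : 0 < a₁) (ha₂ : 0 < a₂)
    (hδ₁0 : 0 < δ₁) (hδ₁₂ : δ₁ < δ₂) (hδ₂1 : δ₂ ≤ 1) (hgap : 1 / 2 ≤ δ₂ - δ₁)
    (α β : ℕ → ℝ)
    (hα : ∀ k : ℕ, α k = a₁ / ((k : ℝ) + 1) ^ δ₁)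
    (hβ : ∀ k : ℕ, β k = a₂ / ((k : ℝ) + 1) ^ δ₂)
    -- the local objective functions
    (n : ℕ) (hn : 1 ≤ n) (l : ℝ) (hl : 0 < l)
    (f : Fin N → EuclideanSpace ℝ (Fin n) → ℝ)
    (hconv : ∀ i, ConvexOn ℝ Set.univ (f i))
    (hsub_ne : ∀ i w, (subdiff (f i) w).Nonempty)
    (hsub_bd : ∀ i w g, g ∈ subdiff (f i) w → ‖g‖ ≤ l)
    (hsolvable : ∃ xs : EuclideanSpace ℝ (Fin n), ∀ z, (∑ i, f i xs) ≤ ∑ i, f i z)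
    -- the consensus subgradient algorithm
    (x : Fin N → ℕ → Ω → EuclideanSpace ℝ (Fin n))
    (hx0 : ∀ i, ∃ c, ∀ ω, x i 0 ω = c)
    (d : Fin N → ℕ → Ω → EuclideanSpace ℝ (Fin n))
    (hd_meas : ∀ i k, Measurable[𝓕 k] (d i k))
    (hd_sub : ∀ i k ω, d i k ω ∈ subdiff (f i) (x i k ω))
    (hupdate : ∀ i k ω,
      x i (k + 1) ω = x i k ω
        + α k • (∑ j, A (θ k ω) i j • (x j k ω - x i k ω))
        - β k • d i k ω)
    -- the network average
    (y : ℕ → Ω → EuclideanSpace ℝ (Fin n))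
    (hy : ∀ k ω, y k ω = ((N : ℝ))⁻¹ • ∑ i, x i k ω) :
    ∀ᵐ ω ∂ℙ, ∀ i : Fin N,
      Tendsto (fun k => ‖x i k ω - y k ω‖) atTop (nhds 0) := by
  have hm' : Nonempty (Fin m) := ⟨⟨0, hm⟩⟩
  have hN0 : (N : ℝ) ≠ 0 := Nat.cast_ne_zero.2 (by omega)
  obtain ⟨L, R, hL1, hLR, hvisit⟩ := exists_log_window_visits hθ_adapt hθ_markov hP_irr
  obtain ⟨c, hc0, hc1, hc⟩ := exists_le_norm_toEuclideanLin_sub hA_nonneg hA_row hconn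
  have hαeq : α = fun k : ℕ => a₁ / ((k : ℝ) + 1) ^ δ₁ := funext hα
  have hβeq : β = fun k : ℕ => a₂ / ((k : ℝ) + 1) ^ δ₂ := funext hβ
  have hα_anti : Antitone α := hαeq ▸ antitone_div_rpow ha₁ hδ₁0
  have hβ_anti : Antitone β := hβeq ▸ antitone_div_rpow ha₂ (hδ₁0.trans hδ₁₂)
  have hα_pos : ∀ k, 0 < α k := fun k => by rw [hα]; positivity
  have hβ_nonneg : ∀ k, 0 ≤ β k := fun k => by rw [hβ]; positivity
  have hα2 : ∀ᶠ k in atTop, α k ≤ 2 * α (k + L k) := by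
    filter_upwards [(tendsto_div_rpow_of_le_log hLR one_pos).eventually_le_const one_pos] with k hk
    rw [Real.rpow_one, div_le_one (by positivity)] at hk
    rw [hα, hα]
    exact div_rpow_le_two_mul_of_le ha₁ hδ₁0 (by linarith) (by exact_mod_cast hk)
  have hLα : Tendsto (fun k => L k * α k) atTop (nhds 0) := by
    have h := (tendsto_div_rpow_of_le_log hLR hδ₁0).const_mul a₁
    rw [mul_zero] at h
    refine h.congr fun k => ?_
    rw [hα]; ring
  have hLβ : Tendsto (fun k => L k * β k / α k) atTop (nhds 0) := by
    have h := (tendsto_div_rpow_of_le_log hLR (sub_pos.2 hδ₁₂)).const_mul (a₂ / a₁)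
    rw [mul_zero] at h
    refine h.congr fun k => ?_
    rw [hα, hβ, Real.rpow_sub (by positivity)]
    field_simp
  have hLk : Tendsto (fun k : ℕ => L k / (((k : ℝ) + 1) * α k)) atTop (nhds 0) := by
    have h := (tendsto_div_rpow_of_le_log hLR
      (sub_pos.2 (hδ₁₂.trans_le hδ₂1))).const_mul (1 / a₁)
    rw [mul_zero] at h
    refine h.congr fun k => ?_
    rw [hα, Real.rpow_sub (by positivity), Real.rpow_one]
    field_simp
  filter_upwards [hvisit] with ω hω
  have hcoord : ∀ r : Fin n, Tendsto (fun k => WithLp.toLp 2 fun i => x i k ω r - y k ω r) atTop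
      (nhds (0 : EuclideanSpace ℝ (Fin N))) := by
    intro r
    have hyr : ∀ k, y k ω r = (N : ℝ)⁻¹ * ∑ i, x i k ω r := fun k => by simp [hy]
    have hd_le : ∀ i k, |d i k ω r| ≤ l := fun i k =>
      (PiLp.norm_apply_le (d i k ω) r).trans (hsub_bd i _ _ (hd_sub i k ω))
    refine tendsto_zero_of_perturbed_relaxed_iteration (B := fun j => toEuclideanLin (A j))
      (θ := fun k => θ k ω) (α := α) (β := β) (L := L) (c := c) (C := √(∑ _i : Fin N, (2 * l) ^ 2))
      (u := fun k => WithLp.toLp 2 fun i => (N : ℝ)⁻¹ * ∑ j, d j k ω r - d i k ω r)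
      (fun j => norm_toEuclideanLin_le_of_doublyStochastic (hA_nonneg j) (hA_row j) (hA_col j))
      ?_ ?_ hc0 hc1 ?_ hα_anti hα_pos hβ_anti hβ_nonneg hL1 hα2 hLα hLβ hLk hω
    · intro k
      ext i
      have h := consensus_error_step (hA_row (θ k ω)) (hA_col (θ k ω)) (a := α k) (b := β k)
        (v := fun i => x i k ω r) (w := fun i => x i (k + 1) ω r) (g := fun i => d i k ω r)
        (fun i => by simp [hupdate]) i
      simpa [toLpLin_apply, hyr] using h
    · intro k
      rw [EuclideanSpace.norm_eq]
      refine Real.sqrt_le_sqrt (Finset.sum_le_sum fun i _ => ?_)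
      have h1 : |∑ j, d j k ω r| ≤ N * l := by
        refine (Finset.abs_sum_le_sum_abs _ _).trans ?_
        simpa using Finset.sum_le_sum fun (j : Fin N) (_ : j ∈ Finset.univ) => hd_le j k
      have h2 : |(N : ℝ)⁻¹ * ∑ j, d j k ω r| ≤ l := by
        rw [abs_mul, abs_of_nonneg (by positivity)]
        calc (N : ℝ)⁻¹ * |∑ j, d j k ω r| ≤ (N : ℝ)⁻¹ * (N * l) := by gcongr
          _ = l := by field_simp
      have h3 : ‖(N : ℝ)⁻¹ * ∑ j, d j k ω r - d i k ω r‖ ≤ 2 * l := by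
        refine (abs_sub _ _).trans ?_
        linarith [hd_le i k]
      gcongr
    · intro k
      refine hc _ ?_
      simp only [hyr, Finset.sum_sub_distrib, Finset.sum_const, Finset.card_univ, Fintype.card_fin,
        nsmul_eq_mul]
      field_simp
      ring
  intro i
  rw [← tendsto_zero_iff_norm_tendsto_zero]
  have h1 : Tendsto (fun k => (x i k ω - y k ω).ofLp) atTop (nhds 0) := by
    refine tendsto_pi_nhds.2 fun r => ?_
    exact ((continuous_apply i).comp (PiLp.continuous_ofLp 2 _)).continuousAt.tendsto.comp
      (hcoord r)
  exact (PiLp.continuous_toLp 2 _).continuousAt.tendsto.comp h1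
end

section
/- Under the stated Markovian switching network model, algorithm, and step-size assumptions, with probability 1, for every agent i ∈ {1,…,N} the step-size-weighted accumulated tracking error is finite: Σ_{k=1}^∞ β_k ‖y(k) − x_i(k)‖ < ∞, where y(k) = (1/N) Σ_{i=1}^N x_i(k). -/
open MeasureTheory Matrix Filter RealInnerProductSpace

section Consensus

variable {ι V : Type*} [Fintype ι] [NormedAddCommGroup V]

/-- The Dirichlet form of a weighted directed graph. -/
def dirichletForm (A : Matrix ι ι ℝ) (e : ι → V) : ℝ :=
  ∑ i, ∑ j, A i j * ‖e i - e j‖ ^ 2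

lemma dirichletForm_nonneg {A : Matrix ι ι ℝ} (hA : ∀ i j, 0 ≤ A i j) (e : ι → V) :
    0 ≤ dirichletForm A e :=
  Finset.sum_nonneg fun i _ => Finset.sum_nonneg fun j _ => mul_nonneg (hA i j) (sq_nonneg _)

variable [InnerProductSpace ℝ V]

lemma norm_sub_sq_le_two_mul (u v : V) : ‖u - v‖ ^ 2 ≤ 2 * ‖u‖ ^ 2 + 2 * ‖v‖ ^ 2 := by
  have h := parallelogram_law_with_norm ℝ u v
  nlinarith [mul_self_nonneg ‖u + v‖]

lemma sum_sum_mul_left_of_row {A : Matrix ι ι ℝ} (hrow : ∀ i, ∑ j, A i j = 1) (g : ι → ℝ) :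
    ∑ i, ∑ j, A i j * g i = ∑ i, g i := by
  simp only [← Finset.sum_mul, hrow, one_mul]

lemma sum_sum_mul_right_of_col {A : Matrix ι ι ℝ} (hcol : ∀ j, ∑ i, A i j = 1) (g : ι → ℝ) :
    ∑ i, ∑ j, A i j * g j = ∑ j, g j := by
  rw [Finset.sum_comm]
  simp only [← Finset.sum_mul, hcol, one_mul]

lemma dirichletForm_le {A : Matrix ι ι ℝ} (hA : ∀ i j, 0 ≤ A i j)
    (hrow : ∀ i, ∑ j, A i j = 1) (hcol : ∀ j, ∑ i, A i j = 1) (e : ι → V) :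
    dirichletForm A e ≤ 4 * ∑ i, ‖e i‖ ^ 2 := by
  calc dirichletForm A e
      ≤ ∑ i, ∑ j, (A i j * (2 * ‖e i‖ ^ 2) + A i j * (2 * ‖e j‖ ^ 2)) := by
        refine Finset.sum_le_sum fun i _ => Finset.sum_le_sum fun j _ => ?_
        rw [← mul_add]
        exact mul_le_mul_of_nonneg_left (norm_sub_sq_le_two_mul _ _) (hA i j)
    _ = 4 * ∑ i, ‖e i‖ ^ 2 := by
        simp only [Finset.sum_add_distrib]
        rw [sum_sum_mul_left_of_row hrow fun i => 2 * ‖e i‖ ^ 2,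
          sum_sum_mul_right_of_col hcol fun i => 2 * ‖e i‖ ^ 2, ← Finset.mul_sum]
        ring

lemma dirichletForm_perturb {A : Matrix ι ι ℝ} (hA : ∀ i j, 0 ≤ A i j) {t : ℝ} (ht : 0 < t)
    (e e' : ι → V) :
    (1 - t) * dirichletForm A e - t⁻¹ * dirichletForm A (e' - e) ≤ dirichletForm A e' := by
  simp only [dirichletForm, Finset.mul_sum, ← Finset.sum_sub_distrib]
  refine Finset.sum_le_sum fun i _ => Finset.sum_le_sum fun j _ => ?_
  set u := e i - e j with hu
  set v := (e' - e) i - (e' - e) j with hv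
  have huv : e' i - e' j = u + v := by simp only [hu, hv, Pi.sub_apply]; abel
  have h2 : ‖u + v‖ ^ 2 = ‖u‖ ^ 2 + 2 * ⟪u, v⟫ + ‖v‖ ^ 2 := norm_add_sq_real u v
  have h3 : -(‖u‖ * ‖v‖) ≤ ⟪u, v⟫ := neg_le_of_abs_le (abs_real_inner_le_norm u v)
  have h4 : 2 * (‖u‖ * ‖v‖) ≤ t * ‖u‖ ^ 2 + t⁻¹ * ‖v‖ ^ 2 := by
    have h5 : t * ‖u‖ ^ 2 + t⁻¹ * ‖v‖ ^ 2 - 2 * (‖u‖ * ‖v‖) = t⁻¹ * (t * ‖u‖ - ‖v‖) ^ 2 := by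
      field_simp
      ring
    have : 0 ≤ t⁻¹ * (t * ‖u‖ - ‖v‖) ^ 2 := by positivity
    linarith
  have h6 : (1 - t) * ‖u‖ ^ 2 - t⁻¹ * ‖v‖ ^ 2 ≤ ‖e' i - e' j‖ ^ 2 := by
    rw [huv, h2]
    nlinarith [sq_nonneg ‖v‖]
  calc _ = A i j * ((1 - t) * ‖u‖ ^ 2 - t⁻¹ * ‖v‖ ^ 2) := by ring
    _ ≤ _ := mul_le_mul_of_nonneg_left h6 (hA i j)

/-- The direction in which the consensus protocol moves the states. -/
def consensusDrift (A : Matrix ι ι ℝ) (e : ι → V) (i : ι) : V :=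
  ∑ j, A i j • (e j - e i)

lemma two_mul_sum_inner_consensusDrift {A : Matrix ι ι ℝ}
    (hrow : ∀ i, ∑ j, A i j = 1) (hcol : ∀ j, ∑ i, A i j = 1) (e : ι → V) :
    2 * ∑ i, ⟪e i, consensusDrift A e i⟫ = -dirichletForm A e := by
  have h : ∀ i j, 2 * ⟪e i, A i j • (e j - e i)⟫
      = A i j * ‖e j‖ ^ 2 - A i j * ‖e i‖ ^ 2 - A i j * ‖e i - e j‖ ^ 2 := by
    intro i j
    rw [norm_sub_sq_real, inner_smul_right, inner_sub_right, real_inner_self_eq_norm_sq]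
    ring
  simp only [consensusDrift, inner_sum, Finset.mul_sum, h, Finset.sum_sub_distrib]
  rw [sum_sum_mul_left_of_row hrow fun i => ‖e i‖ ^ 2,
    sum_sum_mul_right_of_col hcol fun i => ‖e i‖ ^ 2, dirichletForm]
  ring

lemma sum_norm_sq_consensusDrift_le {A : Matrix ι ι ℝ} (hA : ∀ i j, 0 ≤ A i j)
    (hrow : ∀ i, ∑ j, A i j = 1) (e : ι → V) :
    ∑ i, ‖consensusDrift A e i‖ ^ 2 ≤ dirichletForm A e := by
  refine Finset.sum_le_sum fun i _ => ?_
  have h1 : ‖consensusDrift A e i‖ ≤ ∑ j, A i j * ‖e i - e j‖ := by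
    refine (norm_sum_le _ _).trans (Finset.sum_le_sum fun j _ => ?_)
    rw [norm_smul, Real.norm_of_nonneg (hA i j), norm_sub_rev]
  have h2 := (convexOn_pow 2).map_sum_le (t := Finset.univ) (w := A i)
    (p := fun j => ‖e i - e j‖) (fun j _ => hA i j) (hrow i) (fun j _ => norm_nonneg _)
  simp only [smul_eq_mul] at h2
  exact (pow_le_pow_left₀ (norm_nonneg _) h1 2).trans h2

lemma sum_norm_sq_consensus_le {A : Matrix ι ι ℝ} (hA : ∀ i j, 0 ≤ A i j)
    (hrow : ∀ i, ∑ j, A i j = 1) (hcol : ∀ j, ∑ i, A i j = 1) (e : ι → V) (α : ℝ) :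
    ∑ i, ‖e i + α • consensusDrift A e i‖ ^ 2
      ≤ ∑ i, ‖e i‖ ^ 2 - α * dirichletForm A e + α ^ 2 * dirichletForm A e := by
  have h : ∀ i, ‖e i + α • consensusDrift A e i‖ ^ 2
      = ‖e i‖ ^ 2 + α * (2 * ⟪e i, consensusDrift A e i⟫)
        + α ^ 2 * ‖consensusDrift A e i‖ ^ 2 := by
    intro i
    rw [norm_add_sq_real, inner_smul_right, norm_smul, mul_pow, Real.norm_eq_abs, sq_abs]
    ring
  simp only [h, Finset.sum_add_distrib, ← Finset.mul_sum]
  rw [two_mul_sum_inner_consensusDrift hrow hcol]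
  have := mul_le_mul_of_nonneg_left (sum_norm_sq_consensusDrift_le hA hrow e) (sq_nonneg α)
  linarith

lemma norm_sub_sq_le_young {s : ℝ} (hs : 0 < s) (u v : V) :
    ‖u - v‖ ^ 2 ≤ (1 + s) * ‖u‖ ^ 2 + (1 + s⁻¹) * ‖v‖ ^ 2 := by
  have h2 : ‖u - v‖ ^ 2 = ‖u‖ ^ 2 - 2 * ⟪u, v⟫ + ‖v‖ ^ 2 := norm_sub_sq_real u v
  have h3 : -(‖u‖ * ‖v‖) ≤ ⟪u, v⟫ := neg_le_of_abs_le (abs_real_inner_le_norm u v)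
  have h5 : s * ‖u‖ ^ 2 + s⁻¹ * ‖v‖ ^ 2 - 2 * (‖u‖ * ‖v‖) = s⁻¹ * (s * ‖u‖ - ‖v‖) ^ 2 := by
    field_simp
    ring
  have : 0 ≤ s⁻¹ * (s * ‖u‖ - ‖v‖) ^ 2 := by positivity
  linarith

/-- One perturbed consensus step: energy estimate. -/
lemma sum_norm_sq_step_le {A : Matrix ι ι ℝ} (hA : ∀ i j, 0 ≤ A i j)
    (hrow : ∀ i, ∑ j, A i j = 1) (hcol : ∀ j, ∑ i, A i j = 1) {e e' b : ι → V}
    {α β η B : ℝ} (hα0 : 0 < α) (hα1 : α ≤ 1) (hη : 0 < η) (hηα : η * α ≤ 1)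
    (hb : ∑ i, ‖b i‖ ^ 2 ≤ B)
    (he' : ∀ i, e' i = e i + α • consensusDrift A e i - β • b i) :
    ∑ i, ‖e' i‖ ^ 2 ≤ ∑ i, ‖e i‖ ^ 2 - α * dirichletForm A e
      + (4 * α ^ 2 + η * α) * ∑ i, ‖e i‖ ^ 2 + 2 * B * (β ^ 2 / (η * α)) := by
  set S := ∑ i, ‖e i‖ ^ 2 with hS
  set D := dirichletForm A e with hD
  set p : ι → V := fun i => e i + α • consensusDrift A e i with hp
  have hD0 : 0 ≤ D := dirichletForm_nonneg hA e
  have hD4 : D ≤ 4 * S := dirichletForm_le hA hrow hcol e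
  have hpS : ∑ i, ‖p i‖ ^ 2 ≤ S - α * D + α ^ 2 * D :=
    sum_norm_sq_consensus_le hA hrow hcol e α
  have hs : 0 < η * α := mul_pos hη hα0
  have h1 : ∑ i, ‖e' i‖ ^ 2
      ≤ (1 + η * α) * ∑ i, ‖p i‖ ^ 2 + (1 + (η * α)⁻¹) * (β ^ 2 * ∑ i, ‖b i‖ ^ 2) := by
    simp only [Finset.mul_sum, ← Finset.sum_add_distrib]
    refine Finset.sum_le_sum fun i _ => ?_
    rw [he' i]
    refine (norm_sub_sq_le_young hs (p i) (β • b i)).trans_eq ?_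
    rw [norm_smul, mul_pow, Real.norm_eq_abs, sq_abs]
  have hpS' : ∑ i, ‖p i‖ ^ 2 ≤ S := by nlinarith [mul_nonneg hα0.le hD0]
  have h2 : 1 + (η * α)⁻¹ ≤ 2 * (η * α)⁻¹ := by
    have := (one_le_inv₀ hs).2 hηα
    linarith
  have h3 : (1 + (η * α)⁻¹) * (β ^ 2 * ∑ i, ‖b i‖ ^ 2) ≤ 2 * (η * α)⁻¹ * (β ^ 2 * B) := by
    have := Finset.sum_nonneg fun i (_ : i ∈ Finset.univ) => sq_nonneg ‖b i‖
    gcongr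
  have h4 : 2 * (η * α)⁻¹ * (β ^ 2 * B) = 2 * B * (β ^ 2 / (η * α)) := by
    rw [div_eq_mul_inv]; ring
  have h5 : η * α * ∑ i, ‖p i‖ ^ 2 ≤ η * α * S := by gcongr
  have h6 : α ^ 2 * D ≤ α ^ 2 * (4 * S) := by gcongr
  nlinarith

lemma sum_norm_sq_step_le_crude {A : Matrix ι ι ℝ} (hA : ∀ i j, 0 ≤ A i j)
    (hrow : ∀ i, ∑ j, A i j = 1) (hcol : ∀ j, ∑ i, A i j = 1) {e e' b : ι → V}
    {α β B : ℝ} (hα0 : 0 ≤ α) (hb : ∑ i, ‖b i‖ ^ 2 ≤ B)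
    (he' : ∀ i, e' i = e i + α • consensusDrift A e i - β • b i) :
    ∑ i, ‖e' i‖ ^ 2 ≤ 2 * (1 + 4 * α ^ 2) * ∑ i, ‖e i‖ ^ 2 + 2 * (β ^ 2 * B) := by
  have h1 : ∑ i, ‖e' i‖ ^ 2 ≤ 2 * ∑ i, ‖e i + α • consensusDrift A e i‖ ^ 2
      + 2 * (β ^ 2 * ∑ i, ‖b i‖ ^ 2) := by
    simp only [Finset.mul_sum, ← Finset.sum_add_distrib]
    refine Finset.sum_le_sum fun i _ => ?_
    rw [he' i]
    refine (norm_sub_sq_le_two_mul _ _).trans_eq ?_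
    rw [norm_smul, mul_pow, Real.norm_eq_abs, sq_abs]
  have h2 := sum_norm_sq_consensus_le hA hrow hcol e α
  have h3 := mul_nonneg hα0 (dirichletForm_nonneg hA e)
  have h4 := mul_le_mul_of_nonneg_left (dirichletForm_le hA hrow hcol e) (sq_nonneg α)
  have h5 := mul_le_mul_of_nonneg_left hb (sq_nonneg β)
  linarith

/-- One perturbed consensus step: the Dirichlet form of any network cannot drop much. -/
lemma dirichletForm_step_ge {A A' : Matrix ι ι ℝ} (hA : ∀ i j, 0 ≤ A i j)
    (hrow : ∀ i, ∑ j, A i j = 1) (hcol : ∀ j, ∑ i, A i j = 1)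
    (hA' : ∀ i j, 0 ≤ A' i j)
    (hrow' : ∀ i, ∑ j, A' i j = 1) (hcol' : ∀ j, ∑ i, A' i j = 1) {e e' b : ι → V}
    {α β B : ℝ} (hα0 : 0 < α) (hb : ∑ i, ‖b i‖ ^ 2 ≤ B)
    (he' : ∀ i, e' i = e i + α • consensusDrift A e i - β • b i) :
    dirichletForm A' e - (36 * α * ∑ i, ‖e i‖ ^ 2 + 8 * B * (β ^ 2 / α))
      ≤ dirichletForm A' e' := by
  set S := ∑ i, ‖e i‖ ^ 2 with hS
  have h1 := dirichletForm_perturb hA' hα0 e e'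
  have h2 := dirichletForm_le hA' hrow' hcol' e
  have h3 := dirichletForm_le hA' hrow' hcol' (e' - e)
  have h4 : ∑ i, ‖(e' - e) i‖ ^ 2 ≤ 8 * α ^ 2 * S + 2 * β ^ 2 * B := by
    have h5 : ∀ i, ‖(e' - e) i‖ ^ 2
        ≤ 2 * α ^ 2 * ‖consensusDrift A e i‖ ^ 2 + 2 * β ^ 2 * ‖b i‖ ^ 2 := by
      intro i
      have : (e' - e) i = α • consensusDrift A e i - β • b i := by
        rw [Pi.sub_apply, he' i]; abel
      rw [this]
      refine (norm_sub_sq_le_two_mul _ _).trans_eq ?_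
      simp only [norm_smul, mul_pow, Real.norm_eq_abs, sq_abs]
      ring
    refine (Finset.sum_le_sum fun i _ => h5 i).trans ?_
    rw [Finset.sum_add_distrib, ← Finset.mul_sum, ← Finset.mul_sum]
    have h6 := (sum_norm_sq_consensusDrift_le hA hrow e).trans (dirichletForm_le hA hrow hcol e)
    have h7 : 2 * α ^ 2 * ∑ i, ‖consensusDrift A e i‖ ^ 2 ≤ 2 * α ^ 2 * (4 * S) := by gcongr
    have h8 : 2 * β ^ 2 * ∑ i, ‖b i‖ ^ 2 ≤ 2 * β ^ 2 * B := by gcongr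
    linarith
  have h9 : α⁻¹ * dirichletForm A' (e' - e)
      ≤ α⁻¹ * (4 * (8 * α ^ 2 * S + 2 * β ^ 2 * B)) := by
    have := h3.trans (mul_le_mul_of_nonneg_left h4 (by norm_num : (0 : ℝ) ≤ 4))
    gcongr
  have h10 : α⁻¹ * (4 * (8 * α ^ 2 * S + 2 * β ^ 2 * B))
      = 32 * α * S + 8 * B * (β ^ 2 / α) := by
    field_simp
    ring
  nlinarith

lemma exists_norm_sub_sq_le_sum_dirichletForm {κ : Type*} [Fintype κ]
    {A : κ → Matrix ι ι ℝ} (hA : ∀ l i j, 0 ≤ A l i j) {i j : ι}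
    (hij : Relation.ReflTransGen (fun u v => ∃ l, 0 < A l v u) i j) :
    ∃ C : ℝ, 0 ≤ C ∧ ∀ e : ι → V, ‖e i - e j‖ ^ 2 ≤ C * ∑ l, dirichletForm (A l) e := by
  induction hij with
  | refl => exact ⟨0, le_rfl, fun e => by simp⟩
  | @tail u v _ huv ih =>
    obtain ⟨C, hC, h⟩ := ih
    obtain ⟨l, hl⟩ := huv
    refine ⟨2 * C + 2 * (A l v u)⁻¹, by positivity, fun e => ?_⟩
    have h1 : A l v u * ‖e v - e u‖ ^ 2 ≤ ∑ l, dirichletForm (A l) e := by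
      calc A l v u * ‖e v - e u‖ ^ 2
          ≤ ∑ j, A l v j * ‖e v - e j‖ ^ 2 :=
            Finset.single_le_sum (f := fun j => A l v j * ‖e v - e j‖ ^ 2)
              (fun j _ => mul_nonneg (hA l v j) (sq_nonneg _)) (Finset.mem_univ u)
        _ ≤ dirichletForm (A l) e :=
            Finset.single_le_sum (f := fun i => ∑ j, A l i j * ‖e i - e j‖ ^ 2)
              (fun i _ => Finset.sum_nonneg fun j _ => mul_nonneg (hA l i j) (sq_nonneg _))
              (Finset.mem_univ v)
        _ ≤ _ :=
            Finset.single_le_sum (f := fun l => dirichletForm (A l) e)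
              (fun l _ => dirichletForm_nonneg (hA l) e) (Finset.mem_univ l)
    have h2 : ‖e v - e u‖ ^ 2 ≤ (A l v u)⁻¹ * ∑ l, dirichletForm (A l) e := by
      rw [inv_mul_eq_div, le_div_iff₀ hl, mul_comm]
      exact h1
    have h3 : e i - e v = (e i - e u) - (e v - e u) := by abel
    rw [h3]
    have := norm_sub_sq_le_two_mul (e i - e u) (e v - e u)
    have := h e
    linarith

/-- Poincaré inequality for a jointly connected family of networks. -/
lemma exists_poincare {κ : Type*} [Fintype κ] [Nonempty ι]
    {A : κ → Matrix ι ι ℝ} (hA : ∀ l i j, 0 ≤ A l i j)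
    (hconn : ∀ i j, Relation.ReflTransGen (fun u v => ∃ l, 0 < A l v u) i j) :
    ∃ c : ℝ, 0 < c ∧ ∀ e : ι → V, ∑ i, e i = 0 →
      c * ∑ i, ‖e i‖ ^ 2 ≤ ∑ l, dirichletForm (A l) e := by
  choose C hC0 hC using fun i j => exists_norm_sub_sq_le_sum_dirichletForm (V := V) hA (hconn i j)
  set T := ∑ i, ∑ j, C i j with hT
  have hT0 : 0 ≤ T := Finset.sum_nonneg fun i _ => Finset.sum_nonneg fun j _ => hC0 i j
  refine ⟨(T + 1)⁻¹, by positivity, fun e he => ?_⟩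
  set D := ∑ l, dirichletForm (A l) e with hD
  have hD0 : 0 ≤ D := Finset.sum_nonneg fun l _ => dirichletForm_nonneg (hA l) e
  have h1 : ∑ i, ∑ j, ‖e i - e j‖ ^ 2 ≤ T * D := by
    rw [hT, Finset.sum_mul]
    refine Finset.sum_le_sum fun i _ => ?_
    rw [Finset.sum_mul]
    exact Finset.sum_le_sum fun j _ => hC i j e
  have h2 : ∑ i, ∑ j, ‖e i - e j‖ ^ 2 = 2 * Fintype.card ι * ∑ i, ‖e i‖ ^ 2 := by
    simp only [norm_sub_sq_real, Finset.sum_add_distrib, Finset.sum_sub_distrib,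
      ← Finset.mul_sum, ← inner_sum, he, inner_zero_right]
    simp [← Finset.mul_sum]
    ring
  have h3 : (1 : ℝ) ≤ Fintype.card ι := by exact_mod_cast Fintype.card_pos
  have h4 : 0 ≤ ∑ i, ‖e i‖ ^ 2 := Finset.sum_nonneg fun i _ => sq_nonneg _
  rw [inv_mul_le_iff₀ (by positivity)]
  nlinarith

end Consensus

section Chain

variable {κ : Type*} [Fintype κ] [DecidableEq κ]

lemma matrix_pow_nonneg {P : Matrix κ κ ℝ} (hP : ∀ i j, 0 ≤ P i j) (q : ℕ) :
    ∀ i j, 0 ≤ (P ^ q) i j := by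
  induction q with
  | zero =>
    intro i j
    rw [pow_zero, Matrix.one_apply]
    split_ifs <;> norm_num
  | succ q ih =>
    intro i j
    rw [pow_succ, Matrix.mul_apply]
    exact Finset.sum_nonneg fun k _ => mul_nonneg (ih i k) (hP k j)

/-- An approximate solution of the Poisson equation of an irreducible finite chain. -/
lemma exists_poisson {P : Matrix κ κ ℝ} (hP : ∀ i j, 0 ≤ P i j)
    (hirr : ∀ i j, ∃ q : ℕ, 1 ≤ q ∧ 0 < (P ^ q) i j) :
    ∃ (H : Matrix κ κ ℝ) (Q ε : ℝ), (∀ i j, 0 ≤ H i j) ∧ 0 < Q ∧ 0 < ε ∧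
      ∀ i j, H i j - (P * H) i j ≤ Q * (1 : Matrix κ κ ℝ) i j - ε := by
  choose q _ hq using hirr
  set n := ∑ i, ∑ j, q i j + 1 with hn
  have hqn : ∀ i j, q i j < n := by
    intro i j
    have h1 : q i j ≤ ∑ j, q i j :=
      Finset.single_le_sum (f := fun j => q i j) (fun _ _ => Nat.zero_le _) (Finset.mem_univ j)
    have h2 : ∑ j, q i j ≤ ∑ i, ∑ j, q i j :=
      Finset.single_le_sum (f := fun i => ∑ j, q i j) (fun _ _ => Nat.zero_le _)
        (Finset.mem_univ i)
    omega
  have hpos : ∀ i j, 0 < ∑ r ∈ Finset.range n, (P ^ r) i j := fun i j =>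
    Finset.sum_pos' (fun r _ => matrix_pow_nonneg hP r i j)
      ⟨q i j, Finset.mem_range.2 (hqn i j), hq i j⟩
  obtain ⟨ε, hε, hle⟩ : ∃ ε : ℝ, 0 < ε ∧ ∀ i j, ε ≤ ∑ r ∈ Finset.range n, (P ^ r) i j := by
    rcases isEmpty_or_nonempty κ with _ | _
    · exact ⟨1, one_pos, fun i => isEmptyElim i⟩
    · obtain ⟨p, hp⟩ := Finite.exists_min
        fun p : κ × κ => ∑ r ∈ Finset.range n, (P ^ r) p.1 p.2
      exact ⟨_, hpos p.1 p.2, fun i j => hp (i, j)⟩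
  refine ⟨∑ s ∈ Finset.range n, ∑ r ∈ Finset.range s, P ^ r, n, ε, ?_, by positivity, hε, ?_⟩
  · intro i j
    simp only [Matrix.sum_apply]
    exact Finset.sum_nonneg fun s _ => Finset.sum_nonneg fun r _ => matrix_pow_nonneg hP r i j
  · intro i j
    set H := ∑ s ∈ Finset.range n, ∑ r ∈ Finset.range s, P ^ r with hH
    have h1 : H - P * H = (n : ℝ) • (1 : Matrix κ κ ℝ) - ∑ r ∈ Finset.range n, P ^ r := by
      have h2 : ∀ s, ∑ r ∈ Finset.range s, P ^ r - P * ∑ r ∈ Finset.range s, P ^ r = 1 - P ^ s := by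
        intro s
        rw [← mul_neg_geom_sum, sub_mul, one_mul]
      rw [hH, Finset.mul_sum, ← Finset.sum_sub_distrib]
      simp [h2, Finset.sum_sub_distrib, ← Nat.cast_smul_eq_nsmul ℝ]
    have h3 := congrFun (congrFun h1 i) j
    simp only [Matrix.sub_apply, Matrix.smul_apply, smul_eq_mul, Matrix.sum_apply] at h3
    rw [h3]
    have := hle i j
    linarith

end Chain

section Lyapunov

variable {ι κ V : Type*} [Fintype ι] [Fintype κ] [NormedAddCommGroup V]

/-- The combination of the Dirichlet forms of the networks with weights `H i`. -/
def networkPotential (A : κ → Matrix ι ι ℝ) (H : Matrix κ κ ℝ) (i : κ) (e : ι → V) : ℝ :=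
  ∑ l, H i l * dirichletForm (A l) e

lemma networkPotential_mul (A : κ → Matrix ι ι ℝ) (P H : Matrix κ κ ℝ) (i : κ) (e : ι → V) :
    networkPotential A (P * H) i e = ∑ j, P i j * networkPotential A H j e := by
  simp only [networkPotential, Matrix.mul_apply, Finset.sum_mul, Finset.mul_sum]
  rw [Finset.sum_comm]
  simp only [mul_assoc]

variable [InnerProductSpace ℝ V]

lemma networkPotential_le {A : κ → Matrix ι ι ℝ} (hA : ∀ l i j, 0 ≤ A l i j)
    (hrow : ∀ l i, ∑ j, A l i j = 1) (hcol : ∀ l j, ∑ i, A l i j = 1)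
    {H : Matrix κ κ ℝ} (hH : ∀ i j, 0 ≤ H i j) {M : ℝ} (hM : ∀ i, ∑ j, H i j ≤ M)
    (i : κ) (e : ι → V) : networkPotential A H i e ≤ M * (4 * ∑ i, ‖e i‖ ^ 2) := by
  have hS : 0 ≤ ∑ i, ‖e i‖ ^ 2 := Finset.sum_nonneg fun i _ => sq_nonneg _
  calc networkPotential A H i e ≤ ∑ l, H i l * (4 * ∑ i, ‖e i‖ ^ 2) :=
        Finset.sum_le_sum fun l _ =>
          mul_le_mul_of_nonneg_left (dirichletForm_le (hA l) (hrow l) (hcol l) e) (hH i l)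
    _ = (∑ l, H i l) * (4 * ∑ i, ‖e i‖ ^ 2) := by rw [Finset.sum_mul]
    _ ≤ _ := mul_le_mul_of_nonneg_right (hM i) (by positivity)

lemma networkPotential_step_ge {A : κ → Matrix ι ι ℝ} (hA : ∀ l i j, 0 ≤ A l i j)
    (hrow : ∀ l i, ∑ j, A l i j = 1) (hcol : ∀ l j, ∑ i, A l i j = 1)
    {H : Matrix κ κ ℝ} (hH : ∀ i j, 0 ≤ H i j) {M : ℝ} (hM : ∀ i, ∑ j, H i j ≤ M)
    (i l : κ) {e e' b : ι → V} {α β B : ℝ} (hα0 : 0 < α) (hb : ∑ i, ‖b i‖ ^ 2 ≤ B)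
    (he' : ∀ i, e' i = e i + α • consensusDrift (A l) e i - β • b i) :
    networkPotential A H i e - M * (36 * α * ∑ i, ‖e i‖ ^ 2 + 8 * B * (β ^ 2 / α))
      ≤ networkPotential A H i e' := by
  have hB : 0 ≤ B := (Finset.sum_nonneg fun i _ => sq_nonneg ‖b i‖).trans hb
  set R := 36 * α * ∑ i, ‖e i‖ ^ 2 + 8 * B * (β ^ 2 / α) with hR
  have hR0 : 0 ≤ R := by
    have : 0 ≤ ∑ i, ‖e i‖ ^ 2 := Finset.sum_nonneg fun i _ => sq_nonneg _
    positivity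
  have h1 : networkPotential A H i e - (∑ j, H i j) * R ≤ networkPotential A H i e' := by
    rw [networkPotential, Finset.sum_mul, ← Finset.sum_sub_distrib]
    refine Finset.sum_le_sum fun j _ => ?_
    rw [← mul_sub]
    exact mul_le_mul_of_nonneg_left (dirichletForm_step_ge (hA l) (hrow l) (hcol l)
      (hA j) (hrow j) (hcol j) hα0 hb he') (hH i j)
  have := mul_le_mul_of_nonneg_right (hM i) hR0
  linarith

/-- One-step drift of the perturbed Lyapunov function `Q ‖e‖² - α h_θ(e)`, averaged over the next
state of the chain. -/
lemma lyapunov_drift [DecidableEq κ] {A : κ → Matrix ι ι ℝ} (hA : ∀ l i j, 0 ≤ A l i j)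
    (hrow : ∀ l i, ∑ j, A l i j = 1) (hcol : ∀ l j, ∑ i, A l i j = 1)
    {P H : Matrix κ κ ℝ} (hPH : ∀ i j, 0 ≤ (P * H) i j) {Q ε M c₀ : ℝ} (hQ : 0 < Q)
    (hε : 0 < ε) (hc₀ : 0 < c₀)
    (hpoisson : ∀ i j, H i j - (P * H) i j ≤ Q * (1 : Matrix κ κ ℝ) i j - ε)
    (hM : ∀ i, ∑ j, (P * H) i j ≤ M) (hM0 : 0 ≤ M)
    {α α' β B : ℝ} (hα0 : 0 < α) (hα1 : α ≤ 1) (hηα : ε * c₀ / (4 * Q) * α ≤ 1)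
    (hsmall : (4 * Q + 36 * M) * α ≤ ε * c₀ / 4)
    (hα'0 : 0 ≤ α') (hα' : α' ≤ α) (hdiff : (α - α') * (4 * M) ≤ ε * c₀ / 4 * α)
    {l : κ} {e e' b : ι → V} (hb : ∑ i, ‖b i‖ ^ 2 ≤ B)
    (hpoincare : c₀ * ∑ i, ‖e i‖ ^ 2 ≤ ∑ l, dirichletForm (A l) e)
    (he' : ∀ i, e' i = e i + α • consensusDrift (A l) e i - β • b i) :
    Q * ∑ i, ‖e' i‖ ^ 2 - α' * networkPotential A (P * H) l e'
      ≤ Q * ∑ i, ‖e i‖ ^ 2 - α * networkPotential A H l e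
        - ε * c₀ / 4 * (α * ∑ i, ‖e i‖ ^ 2)
        + (2 * Q * B / (ε * c₀ / (4 * Q)) + 8 * M * B) * (β ^ 2 / α) := by
  set η := ε * c₀ / (4 * Q) with hη
  have hη0 : 0 < η := by positivity
  have hQη : Q * η = ε * c₀ / 4 := by rw [hη]; field_simp
  have hB : 0 ≤ B := (Finset.sum_nonneg fun i _ => sq_nonneg ‖b i‖).trans hb
  have hstep := sum_norm_sq_step_le (hA l) (hrow l) (hcol l) hα0 hα1 hη0 hηα hb he'
  have hpot := networkPotential_step_ge hA hrow hcol hPH hM l l hα0 hb he'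
  have hG4 := networkPotential_le hA hrow hcol hPH hM l e
  have hS : 0 ≤ ∑ i, ‖e i‖ ^ 2 := Finset.sum_nonneg fun i _ => sq_nonneg _
  have hdiffpot : networkPotential A H l e - networkPotential A (P * H) l e
      ≤ Q * dirichletForm (A l) e - ε * (c₀ * ∑ i, ‖e i‖ ^ 2) := by
    have h1 : networkPotential A H l e - networkPotential A (P * H) l e
        ≤ Q * dirichletForm (A l) e - ε * ∑ j, dirichletForm (A j) e := by
      have h2 : Q * dirichletForm (A l) e
          = ∑ j, Q * (1 : Matrix κ κ ℝ) l j * dirichletForm (A j) e := by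
        simp [Matrix.one_apply]
      rw [h2, networkPotential, networkPotential, Finset.mul_sum, ← Finset.sum_sub_distrib,
        ← Finset.sum_sub_distrib]
      refine Finset.sum_le_sum fun j _ => ?_
      rw [← sub_mul, ← sub_mul]
      exact mul_le_mul_of_nonneg_right (hpoisson l j) (dirichletForm_nonneg (hA j) e)
    have := mul_le_mul_of_nonneg_left hpoincare hε.le
    linarith
  set S := ∑ i, ‖e i‖ ^ 2
  set S' := ∑ i, ‖e' i‖ ^ 2
  set D := dirichletForm (A l) e
  set h := networkPotential A H l e
  set G := networkPotential A (P * H) l e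
  set G' := networkPotential A (P * H) l e'
  set ρ := β ^ 2 / α with hρ
  have hρ0 : 0 ≤ ρ := by positivity
  have hρη : β ^ 2 / (η * α) = ρ / η := by rw [hρ]; field_simp
  rw [hρη] at hstep
  have e1 : Q * S' ≤ Q * (S - α * D + (4 * α ^ 2 + η * α) * S + 2 * B * (ρ / η)) := by gcongr
  have e2 : α' * (G - M * (36 * α * S + 8 * B * ρ)) ≤ α' * G' := by gcongr
  have e3 : α' * (M * (36 * α * S + 8 * B * ρ)) ≤ α * (M * (36 * α * S + 8 * B * ρ)) := by
    gcongr
  have e4 : (α - α') * G ≤ (α - α') * (M * (4 * S)) :=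
    mul_le_mul_of_nonneg_left hG4 (by linarith)
  have e5 : (α - α') * (4 * M) * S ≤ ε * c₀ / 4 * α * S := by gcongr
  have e6 : α * (h - G) ≤ α * (Q * D - ε * (c₀ * S)) := by gcongr
  have e7 : (4 * Q + 36 * M) * α * (α * S) ≤ ε * c₀ / 4 * (α * S) := by gcongr
  have e8 : α * (M * (8 * B * ρ)) ≤ 1 * (M * (8 * B * ρ)) := by gcongr
  have e9 : Q * (η * α * S) = ε * c₀ / 4 * (α * S) := by rw [← hQη]; ring
  have e10 : (2 * Q * B / η + 8 * M * B) * ρ = Q * (2 * B * (ρ / η)) + 1 * (M * (8 * B * ρ)) := by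
    field_simp
  rw [e10]
  linear_combination e1 + e2 + e3 + e4 + e5 + e6 + e7 + e8 + e9

end Lyapunov

section Probability

variable {Ω : Type*} {m0 : MeasurableSpace Ω} {μ : Measure Ω}

lemma ae_summable_of_summable_integral {F : ℕ → Ω → ℝ} (hF : ∀ k ω, 0 ≤ F k ω)
    (hF_int : ∀ k, Integrable (F k) μ) (hsum : Summable fun k => ∫ ω, F k ω ∂μ) :
    ∀ᵐ ω ∂μ, Summable fun k => F k ω := by
  have h := summable_norm_of_tsum_eLpNorm_ne_top (μ := μ) le_rfl
    (fun k => (hF_int k).aestronglyMeasurable) (by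
      have h1 : ∀ k, eLpNorm (F k) 1 μ = ENNReal.ofReal (∫ ω, F k ω ∂μ) := by
        intro k
        rw [eLpNorm_one_eq_lintegral_enorm, ← ofReal_integral_norm_eq_lintegral_enorm (hF_int k)]
        simp only [Real.norm_of_nonneg (hF k _)]
      simp only [h1]
      exact hsum.tsum_ofReal_ne_top)
  filter_upwards [h] with ω hω
  simpa only [Real.norm_of_nonneg (hF _ ω)] using hω

/-- A deterministic Robbins–Siegmund lemma. -/
lemma summable_of_drift {w u r : ℕ → ℝ} {c : ℝ} (hc : 0 < c) (hu : ∀ k, 0 ≤ u k)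
    (hr0 : ∀ k, 0 ≤ r k) (hr : Summable r) {K : ℕ} (hw : ∀ k, K ≤ k → 0 ≤ w k)
    (hstep : ∀ k, K ≤ k → w (k + 1) ≤ w k - c * u k + r k) : Summable u := by
  rw [← summable_nat_add_iff K]
  have hr' : Summable fun k => r (k + K) := (summable_nat_add_iff K).2 hr
  have h : ∀ n, w (n + K) + c * ∑ k ∈ Finset.range n, u (k + K)
      ≤ w K + ∑ k ∈ Finset.range n, r (k + K) := by
    intro n
    induction n with
    | zero => simp
    | succ n ih =>
      have := hstep (n + K) (Nat.le_add_left _ _)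
      rw [Finset.sum_range_succ, Finset.sum_range_succ, add_right_comm n 1 K]
      linarith
  refine summable_of_sum_range_le (c := (w K + ∑' k, r (k + K)) / c) (fun k => hu _) fun n => ?_
  rw [le_div_iff₀ hc]
  have h1 := hr'.sum_le_tsum (Finset.range n) fun k _ => hr0 _
  have h2 := hw (n + K) (Nat.le_add_left _ _)
  have h3 := h n
  linarith

/-- Averaging over the next state of a Markov chain. -/
lemma integral_comp_markov [IsFiniteMeasure μ] {κ : Type*} [Fintype κ] [MeasurableSpace κ]
    [MeasurableSingletonClass κ] {m' : MeasurableSpace Ω} (hm' : m' ≤ m0) {P : Matrix κ κ ℝ}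
    {θ θ' : Ω → κ} (hθ' : Measurable[m0] θ')
    (hmarkov : ∀ j, μ[Set.indicator {ω | θ' ω = j} (fun _ => (1 : ℝ))|m']
      =ᵐ[μ] fun ω => P (θ ω) j)
    {G : κ → Ω → ℝ} (hG : ∀ j, Measurable[m'] (G j)) {C : ℝ} (hC : ∀ j ω, ‖G j ω‖ ≤ C) :
    Integrable (fun ω => G (θ' ω) ω) μ ∧ Integrable (fun ω => ∑ j, P (θ ω) j * G j ω) μ ∧
      ∫ ω, G (θ' ω) ω ∂μ = ∫ ω, ∑ j, P (θ ω) j * G j ω ∂μ := by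
  classical
  set I : κ → Ω → ℝ := fun j => Set.indicator {ω | θ' ω = j} (fun _ => (1 : ℝ)) with hI
  have hset : ∀ j, MeasurableSet[m0] {ω | θ' ω = j} := fun j => hθ' (measurableSet_singleton j)
  have hIint : ∀ j, Integrable (I j) μ := fun j => (integrable_const 1).indicator (hset j)
  have hGI : ∀ j, Integrable (G j * I j) μ := by
    intro j
    refine (hIint j).bdd_mul (c := C) ((hG j).mono hm' le_rfl).aestronglyMeasurable ?_
    exact ae_of_all _ (hC j)
  have hpull : ∀ j, μ[G j * I j|m'] =ᵐ[μ] fun ω => P (θ ω) j * G j ω := by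
    intro j
    filter_upwards [condExp_mul_of_stronglyMeasurable_left (hG j).stronglyMeasurable (hGI j)
      (hIint j), hmarkov j] with ω h1 h2
    rw [h1, Pi.mul_apply, h2, mul_comm]
  have hPint : ∀ j, Integrable (fun ω => P (θ ω) j * G j ω) μ := fun j =>
    integrable_condExp.congr (hpull j)
  have hsum : (fun ω => G (θ' ω) ω) = fun ω => ∑ j, (G j * I j) ω := by
    funext ω
    simp [hI, Set.indicator_apply]
  refine ⟨?_, integrable_finsetSum _ fun j _ => hPint j, ?_⟩
  · rw [hsum]
    exact integrable_finsetSum _ fun j _ => hGI j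
  · rw [hsum, integral_finsetSum _ fun j _ => hGI j, integral_finsetSum _ fun j _ => hPint j]
    refine Finset.sum_congr rfl fun j _ => ?_
    rw [← integral_condExp hm', integral_congr_ae (hpull j)]

end Probability

section SwitchedConsensus

variable {ι κ V : Type*} [Fintype ι] [Fintype κ] [NormedAddCommGroup V]
  [MeasurableSpace V] [BorelSpace V] [SecondCountableTopology V]

lemma measurable_dirichletForm {Ω : Type*} {_ : MeasurableSpace Ω} (A : Matrix ι ι ℝ)
    {e : Ω → ι → V} (he : ∀ i, Measurable fun ω => e ω i) :
    Measurable fun ω => dirichletForm A (e ω) :=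
  Finset.measurable_fun_sum _ fun i _ => Finset.measurable_fun_sum _ fun j _ =>
    (((he i).sub (he j)).norm.pow_const 2).const_mul _

variable [MeasurableSpace κ] [MeasurableSingletonClass κ]

lemma measurable_networkPotential {Ω : Type*} {_ : MeasurableSpace Ω} (A : κ → Matrix ι ι ℝ)
    (H : Matrix κ κ ℝ) {θ : Ω → κ} (hθ : Measurable θ) {e : Ω → ι → V}
    (he : ∀ i, Measurable fun ω => e ω i) :
    Measurable fun ω => networkPotential A H (θ ω) (e ω) :=
  Finset.measurable_fun_sum _ fun l _ =>
    ((measurable_of_finite fun i => H i l).comp hθ).mul (measurable_dirichletForm (A l) he)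

variable [InnerProductSpace ℝ V]

lemma measurable_consensus_step {Ω : Type*} {_ : MeasurableSpace Ω} (A : κ → Matrix ι ι ℝ)
    {θ : Ω → κ} (hθ : Measurable θ) {e b : Ω → ι → V}
    (he : ∀ i, Measurable fun ω => e ω i) (hb : ∀ i, Measurable fun ω => b ω i)
    (α β : ℝ) (i : ι) :
    Measurable fun ω => e ω i + α • consensusDrift (A (θ ω)) (e ω) i - β • b ω i := by
  have h : Measurable fun ω => consensusDrift (A (θ ω)) (e ω) i :=
    Finset.measurable_fun_sum _ fun j _ =>
      ((measurable_of_finite fun l => A l i j).comp hθ).smul ((he j).sub (he i))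
  exact ((he i).add (h.const_smul α)).sub ((hb i).const_smul β)

/-- Under Markovian switching, the disagreement energy weighted by the consensus step sizes is
almost surely summable. -/
theorem ae_summable_mul_disagreement [DecidableEq κ] [Nonempty ι] {Ω : Type*}
    {m0 : MeasurableSpace Ω} {μ : Measure Ω} [IsProbabilityMeasure μ] {𝓕 : Filtration ℕ m0}
    {P : Matrix κ κ ℝ} (hP : ∀ i j, 0 ≤ P i j)
    (hirr : ∀ i j, ∃ q : ℕ, 1 ≤ q ∧ 0 < (P ^ q) i j)
    {θ : ℕ → Ω → κ} (hθ : ∀ k, Measurable[𝓕 k] (θ k))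
    (hmarkov : ∀ k j, μ[Set.indicator {ω | θ (k + 1) ω = j} (fun _ => (1 : ℝ))|𝓕 k]
      =ᵐ[μ] fun ω => P (θ k ω) j)
    {A : κ → Matrix ι ι ℝ} (hA : ∀ l i j, 0 ≤ A l i j)
    (hrow : ∀ l i, ∑ j, A l i j = 1) (hcol : ∀ l j, ∑ i, A l i j = 1)
    (hconn : ∀ i j, Relation.ReflTransGen (fun u v => ∃ l, 0 < A l v u) i j)
    {α β : ℕ → ℝ} (hα0 : ∀ k, 0 < α k) (hanti : ∀ k, α (k + 1) ≤ α k)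
    (hlim : Tendsto α atTop (nhds 0))
    (hdiff : Tendsto (fun k => (α k - α (k + 1)) / α k) atTop (nhds 0))
    (hβα : Summable fun k => β k ^ 2 / α k)
    {e b : ℕ → Ω → ι → V} {B : ℝ} (hb : ∀ k ω, ∑ i, ‖b k ω i‖ ^ 2 ≤ B)
    (hb_meas : ∀ k i, Measurable[𝓕 k] fun ω => b k ω i)
    (he0 : ∃ c, ∀ ω, e 0 ω = c) (hmean : ∀ k ω, ∑ i, e k ω i = 0)
    (hstep : ∀ k ω i, e (k + 1) ω i
      = e k ω i + α k • consensusDrift (A (θ k ω)) (e k ω) i - β k • b k ω i) :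
    ∀ᵐ ω ∂μ, Summable fun k => α k * ∑ i, ‖e k ω i‖ ^ 2 := by
  obtain ⟨ω₀⟩ : Nonempty Ω := nonempty_of_isProbabilityMeasure μ
  have hB : 0 ≤ B := (Finset.sum_nonneg fun i _ => sq_nonneg ‖b 0 ω₀ i‖).trans (hb 0 ω₀)
  obtain ⟨c₀, hc₀, hpoincare⟩ := exists_poincare (V := V) hA hconn
  obtain ⟨H, Q, ε, hH, hQ, hε, hpoisson⟩ := exists_poisson hP hirr
  have hPH : ∀ i j, 0 ≤ (P * H) i j := fun i j => by
    rw [Matrix.mul_apply]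
    exact Finset.sum_nonneg fun k _ => mul_nonneg (hP i k) (hH k j)
  obtain ⟨M, hM0, hMH, hMPH⟩ : ∃ M : ℝ, 0 ≤ M ∧ (∀ i, ∑ j, H i j ≤ M) ∧
      ∀ i, ∑ j, (P * H) i j ≤ M := by
    have h1 : ∀ (T : Matrix κ κ ℝ), (∀ i j, 0 ≤ T i j) → ∀ i, ∑ j, T i j ≤ ∑ i, ∑ j, T i j :=
      fun T hT i => Finset.single_le_sum (f := fun i => ∑ j, T i j)
        (fun i _ => Finset.sum_nonneg fun j _ => hT i j) (Finset.mem_univ i)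
    have h2 : ∀ (T : Matrix κ κ ℝ), (∀ i j, 0 ≤ T i j) → 0 ≤ ∑ i, ∑ j, T i j :=
      fun T hT => Finset.sum_nonneg fun i _ => Finset.sum_nonneg fun j _ => hT i j
    refine ⟨∑ i, ∑ j, H i j + ∑ i, ∑ j, (P * H) i j, add_nonneg (h2 _ hH) (h2 _ hPH),
      fun i => ?_, fun i => ?_⟩
    · linarith [h1 H hH i, h2 _ hPH]
    · linarith [h1 _ hPH i, h2 _ hH]
  -- regularity of the error process
  have he_succ : ∀ k, (∀ i, Measurable[𝓕 k] fun ω => e k ω i) →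
      ∀ i, Measurable[𝓕 k] fun ω => e (k + 1) ω i := by
    intro k hk i
    simp only [hstep]
    exact measurable_consensus_step A (hθ k) hk (hb_meas k) (α k) (β k) i
  have he_meas : ∀ k i, Measurable[𝓕 k] fun ω => e k ω i := by
    intro k
    induction k with
    | zero =>
      intro i
      obtain ⟨c, hc⟩ := he0
      simp only [hc]
      exact measurable_const
    | succ k ih => exact fun i => (he_succ k ih i).mono (𝓕.mono (Nat.le_succ k)) le_rfl
  have he_meas' : ∀ k i, Measurable[m0] fun ω => e k ω i :=
    fun k i => (he_meas k i).mono (𝓕.le k) le_rfl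
  have he_bdd : ∀ k, ∃ C, ∀ ω, ∑ i, ‖e k ω i‖ ^ 2 ≤ C := by
    intro k
    induction k with
    | zero =>
      obtain ⟨c, hc⟩ := he0
      exact ⟨∑ i, ‖c i‖ ^ 2, fun ω => by rw [hc ω]⟩
    | succ k ih =>
      obtain ⟨C, hC⟩ := ih
      refine ⟨2 * (1 + 4 * α k ^ 2) * C + 2 * (β k ^ 2 * B), fun ω => ?_⟩
      refine (sum_norm_sq_step_le_crude (hA _) (hrow _) (hcol _) (hα0 k).le (hb k ω)
        (hstep k ω)).trans ?_
      have := hC ω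
      gcongr
  choose C hC using he_bdd
  have hS0 : ∀ k ω, 0 ≤ ∑ i, ‖e k ω i‖ ^ 2 :=
    fun k ω => Finset.sum_nonneg fun i _ => sq_nonneg _
  have hS_int : ∀ k, Integrable (fun ω => ∑ i, ‖e k ω i‖ ^ 2) μ := by
    intro k
    refine Integrable.of_bound (Finset.measurable_fun_sum _ fun i _ =>
      ((he_meas' k i).norm.pow_const 2)).aestronglyMeasurable (C k) (ae_of_all _ fun ω => ?_)
    rw [Real.norm_of_nonneg (hS0 k ω)]
    exact hC k ω
  have hpot0 : ∀ (T : Matrix κ κ ℝ), (∀ i j, 0 ≤ T i j) → ∀ l (z : ι → V),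
      0 ≤ networkPotential A T l z := fun T hT l z =>
    Finset.sum_nonneg fun j _ => mul_nonneg (hT l j) (dirichletForm_nonneg (hA j) z)
  have hpot_bdd : ∀ k l ω, ‖networkPotential A H l (e k ω)‖ ≤ M * (4 * C k) := by
    intro k l ω
    rw [Real.norm_of_nonneg (hpot0 H hH l _)]
    refine (networkPotential_le hA hrow hcol hH hMH l _).trans ?_
    have := hC k ω
    gcongr
  have hpot_int : ∀ k, Integrable (fun ω => networkPotential A H (θ k ω) (e k ω)) μ := by
    intro k
    exact Integrable.of_bound (measurable_networkPotential A H ((hθ k).mono (𝓕.le k) le_rfl)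
      (he_meas' k)).aestronglyMeasurable _ (ae_of_all _ fun ω => hpot_bdd k _ ω)
  -- the Lyapunov function
  set W : ℕ → Ω → ℝ := fun k ω =>
    Q * ∑ i, ‖e k ω i‖ ^ 2 - α k * networkPotential A H (θ k ω) (e k ω) with hW
  have hW_int : ∀ k, Integrable (W k) μ := fun k =>
    ((hS_int k).const_mul Q).sub ((hpot_int k).const_mul (α k))
  set c := ε * c₀ / 4 with hc
  have hc_pos : 0 < c := by positivity
  set L := 2 * Q * B / (ε * c₀ / (4 * Q)) + 8 * M * B with hL
  have hL0 : 0 ≤ L := by positivity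
  have hev : ∀ (a t : ℝ), 0 < t → ∀ᶠ k in atTop, a * α k ≤ t := fun a t ht => by
    have := hlim.const_mul a
    rw [mul_zero] at this
    exact this.eventually_le_const ht
  have hev' : ∀ᶠ k in atTop, (α k - α (k + 1)) * (4 * M) ≤ c * α k := by
    have := hdiff.mul_const (4 * M)
    rw [zero_mul] at this
    filter_upwards [this.eventually_le_const hc_pos] with k hk
    rw [div_mul_eq_mul_div, div_le_iff₀ (hα0 k)] at hk
    exact hk
  obtain ⟨K, hK⟩ := eventually_atTop.1 ((hev 1 1 one_pos).and
    ((hev (ε * c₀ / (4 * Q)) 1 one_pos).and ((hev (4 * Q + 36 * M) c hc_pos).and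
      ((hev (4 * M) Q hQ).and hev'))))
  have hdrift : ∀ k, K ≤ k → ∫ ω, W (k + 1) ω ∂μ
      ≤ ∫ ω, W k ω ∂μ - c * (∫ ω, α k * ∑ i, ‖e k ω i‖ ^ 2 ∂μ) + L * (β k ^ 2 / α k) := by
    intro k hk
    obtain ⟨h1, h2, h3, -, h5⟩ := hK k hk
    rw [one_mul] at h1
    obtain ⟨-, hi, heq⟩ := integral_comp_markov (𝓕.le k)
      ((hθ (k + 1)).mono (𝓕.le (k + 1)) le_rfl) (hmarkov k)
      (G := fun j ω => networkPotential A H j (e (k + 1) ω))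
      (fun j => measurable_networkPotential A H measurable_const
        (he_succ k (he_meas k))) (hpot_bdd (k + 1))
    calc ∫ ω, W (k + 1) ω ∂μ
        = ∫ ω, Q * ∑ i, ‖e (k + 1) ω i‖ ^ 2 ∂μ
          - α (k + 1) * ∫ ω, networkPotential A H (θ (k + 1) ω) (e (k + 1) ω) ∂μ := by
          rw [integral_sub ((hS_int (k + 1)).const_mul Q) ((hpot_int (k + 1)).const_mul _),
            integral_const_mul (α (k + 1))]
      _ = ∫ ω, (Q * ∑ i, ‖e (k + 1) ω i‖ ^ 2
          - α (k + 1) * ∑ j, P (θ k ω) j * networkPotential A H j (e (k + 1) ω)) ∂μ := by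
          rw [heq, integral_sub ((hS_int (k + 1)).const_mul Q) (hi.const_mul _),
            integral_const_mul (α (k + 1))]
      _ ≤ ∫ ω, (W k ω - c * (α k * ∑ i, ‖e k ω i‖ ^ 2) + L * (β k ^ 2 / α k)) ∂μ := by
          refine integral_mono (((hS_int (k + 1)).const_mul Q).sub (hi.const_mul _))
            (((hW_int k).sub (((hS_int k).const_mul _).const_mul c)).add
              (integrable_const _)) fun ω => ?_
          have := lyapunov_drift hA hrow hcol hPH hQ hε hc₀ hpoisson hMPH hM0 (hα0 k) h1 h2 h3
            (hα0 (k + 1)).le (hanti k) h5 (hb k ω) (hpoincare (e k ω) (hmean k ω)) (hstep k ω)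
          rw [networkPotential_mul] at this
          exact this
      _ = _ := by
          have hu : Integrable (fun ω => c * (α k * ∑ i, ‖e k ω i‖ ^ 2)) μ :=
            ((hS_int k).const_mul _).const_mul c
          have hWu : Integrable (fun ω => W k ω - c * (α k * ∑ i, ‖e k ω i‖ ^ 2)) μ :=
            (hW_int k).sub hu
          rw [integral_add hWu (integrable_const _), integral_sub (hW_int k) hu,
            integral_const_mul c, integral_const]
          simp
  have hWnonneg : ∀ k, K ≤ k → 0 ≤ ∫ ω, W k ω ∂μ := by
    intro k hk
    obtain ⟨-, -, -, h4, -⟩ := hK k hk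
    refine integral_nonneg fun ω => ?_
    have h6 := mul_le_mul_of_nonneg_left
      (networkPotential_le hA hrow hcol hH hMH (θ k ω) (e k ω)) (hα0 k).le
    have h7 := mul_le_mul_of_nonneg_right h4 (hS0 k ω)
    simp only [hW, Pi.zero_apply]
    linarith
  have hnonneg : ∀ k ω, 0 ≤ α k * ∑ i, ‖e k ω i‖ ^ 2 :=
    fun k ω => mul_nonneg (hα0 k).le (hS0 k ω)
  exact ae_summable_of_summable_integral hnonneg (fun k => (hS_int k).const_mul _)
    (summable_of_drift hc_pos (fun k => integral_nonneg (hnonneg k))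
      (fun k => mul_nonneg hL0 (div_nonneg (sq_nonneg _) (hα0 k).le)) (hβα.mul_left L)
      hWnonneg hdrift)

end SwitchedConsensus

section StepSizes

lemma tendsto_const_div_add_one_rpow (a : ℝ) {δ : ℝ} (hδ : 0 < δ) :
    Tendsto (fun k : ℕ => a / ((k : ℝ) + 1) ^ δ) atTop (nhds 0) :=
  tendsto_const_nhds.div_atTop ((tendsto_rpow_atTop hδ).comp
    (tendsto_atTop_add_const_right _ _ tendsto_natCast_atTop_atTop))

lemma const_div_add_one_rpow_succ_le {a δ : ℝ} (ha : 0 ≤ a) (hδ : 0 ≤ δ) (k : ℕ) :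
    a / (((k + 1 : ℕ) : ℝ) + 1) ^ δ ≤ a / ((k : ℝ) + 1) ^ δ := by
  push_cast
  gcongr
  linarith

lemma tendsto_step_relative_decrease {a δ : ℝ} (ha : 0 < a) (hδ : 0 ≤ δ) (hδ1 : δ ≤ 1) :
    Tendsto (fun k : ℕ => (a / ((k : ℝ) + 1) ^ δ - a / (((k + 1 : ℕ) : ℝ) + 1) ^ δ)
      / (a / ((k : ℝ) + 1) ^ δ)) atTop (nhds 0) := by
  have hlim : Tendsto (fun k : ℕ => 1 / ((k : ℝ) + 1)) atTop (nhds 0) :=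
    tendsto_one_div_add_atTop_nhds_zero_nat
  refine squeeze_zero (fun k => ?_) (fun k => ?_) hlim
  · have := const_div_add_one_rpow_succ_le ha.le hδ k
    exact div_nonneg (sub_nonneg.2 this) (by positivity)
  · have hk : (0 : ℝ) < (k : ℝ) + 1 := by positivity
    have hk' : (0 : ℝ) < ((k + 1 : ℕ) : ℝ) + 1 := by positivity
    have h1 : ((k : ℝ) + 1) / (((k + 1 : ℕ) : ℝ) + 1)
        ≤ (((k : ℝ) + 1) / (((k + 1 : ℕ) : ℝ) + 1)) ^ δ := by
      refine Real.self_le_rpow_of_le_one (by positivity) ?_ hδ1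
      rw [div_le_one hk']
      push_cast
      linarith
    rw [Real.div_rpow hk.le hk'.le] at h1
    have h2 : (a / ((k : ℝ) + 1) ^ δ - a / (((k + 1 : ℕ) : ℝ) + 1) ^ δ)
        / (a / ((k : ℝ) + 1) ^ δ)
        = 1 - ((k : ℝ) + 1) ^ δ / (((k + 1 : ℕ) : ℝ) + 1) ^ δ := by
      have : (0 : ℝ) < ((k : ℝ) + 1) ^ δ := by positivity
      have : (0 : ℝ) < (((k + 1 : ℕ) : ℝ) + 1) ^ δ := by positivity
      field_simp
    rw [h2]
    have h3 : 1 - ((k : ℝ) + 1) / (((k + 1 : ℕ) : ℝ) + 1) ≤ 1 / ((k : ℝ) + 1) := by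
      rw [one_sub_div hk'.ne', div_le_div_iff₀ hk' hk]
      push_cast
      nlinarith
    linarith

lemma summable_step_sq_div_step {a₁ a₂ δ₁ δ₂ : ℝ} (hδ : 1 < 2 * δ₂ - δ₁) :
    Summable fun k : ℕ => (a₂ / ((k : ℝ) + 1) ^ δ₂) ^ 2 / (a₁ / ((k : ℝ) + 1) ^ δ₁) := by
  have h1 : Summable fun k : ℕ => 1 / (((k + 1 : ℕ) : ℝ)) ^ (2 * δ₂ - δ₁) :=
    (summable_nat_add_iff 1).2 (Real.summable_one_div_nat_rpow.2 hδ)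
  refine (h1.mul_left (a₂ ^ 2 / a₁)).congr fun k => ?_
  have hk : (0 : ℝ) < (k : ℝ) + 1 := by positivity
  push_cast
  rw [Real.rpow_sub hk, two_mul, Real.rpow_add hk]
  have : (0 : ℝ) < ((k : ℝ) + 1) ^ δ₁ := by positivity
  have : (0 : ℝ) < ((k : ℝ) + 1) ^ δ₂ := by positivity
  rcases eq_or_ne a₁ 0 with rfl | _
  · simp
  · field_simp

end StepSizes

/-- **Weighted accumulated tracking error.** Under the Markovian switching network
model, the consensus subgradient algorithm, and the step-size assumptions, with probability 1, for
every agent `i`, `Σ_{k=1}^∞ β_k ‖y(k) − x_i(k)‖ < ∞`, where `y(k) = (1/N) Σ_i x_i(k)`. -/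
theorem stmt1 {Ω : Type*} {m0 : MeasurableSpace Ω} (ℙ : Measure Ω)
    [IsProbabilityMeasure ℙ] (𝓕 : Filtration ℕ m0)
    -- the Markovian switching communication network
    (m : ℕ) (hm : 1 ≤ m)
    (P : Matrix (Fin m) (Fin m) ℝ)
    (hP_nonneg : ∀ i j, 0 ≤ P i j)
    (hP_row : ∀ i, ∑ j, P i j = 1)
    (hP_irr : ∀ i j, ∃ q : ℕ, 1 ≤ q ∧ 0 < (P ^ q) i j)
    (θ : ℕ → Ω → Fin m)
    (hθ_adapt : ∀ k, Measurable[𝓕 k] (θ k))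
    (hθ_markov : ∀ k (j : Fin m),
      ℙ[Set.indicator {ω | θ (k + 1) ω = j} (fun _ => (1 : ℝ))|𝓕 k]
        =ᵐ[ℙ] fun ω => P (θ k ω) j)
    (N : ℕ) (hN : 2 ≤ N)
    (A : Fin m → Matrix (Fin N) (Fin N) ℝ)
    (hA_nonneg : ∀ l i j, 0 ≤ A l i j)
    (hA_row : ∀ l i, ∑ j, A l i j = 1)
    (hA_col : ∀ l j, ∑ i, A l i j = 1)
    (hconn : ∀ i j : Fin N,
      Relation.ReflTransGen (fun u v : Fin N => ∃ l, 0 < A l v u) i j)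
    -- the two time-scale step sizes
    (a₁ a₂ δ₁ δ₂ : ℝ) (ha₁ : 0 < a₁) (ha₂ : 0 < a₂)
    (hδ₁0 : 0 < δ₁) (hδ₁₂ : δ₁ < δ₂) (hδ₂1 : δ₂ ≤ 1) (hgap : 1 / 2 ≤ δ₂ - δ₁)
    (α β : ℕ → ℝ)
    (hα : ∀ k : ℕ, α k = a₁ / ((k : ℝ) + 1) ^ δ₁)
    (hβ : ∀ k : ℕ, β k = a₂ / ((k : ℝ) + 1) ^ δ₂)
    -- the local objective functions
    (n : ℕ) (hn : 1 ≤ n) (l : ℝ) (hl : 0 < l)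
    (f : Fin N → EuclideanSpace ℝ (Fin n) → ℝ)
    (hconv : ∀ i, ConvexOn ℝ Set.univ (f i))
    (hsub_ne : ∀ i w, (subdiff (f i) w).Nonempty)
    (hsub_bd : ∀ i w g, g ∈ subdiff (f i) w → ‖g‖ ≤ l)
    (hsolvable : ∃ xs : EuclideanSpace ℝ (Fin n), ∀ z, (∑ i, f i xs) ≤ ∑ i, f i z)
    -- the consensus subgradient algorithm
    (x : Fin N → ℕ → Ω → EuclideanSpace ℝ (Fin n))
    (hx0 : ∀ i, ∃ c, ∀ ω, x i 0 ω = c)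
    (d : Fin N → ℕ → Ω → EuclideanSpace ℝ (Fin n))
    (hd_meas : ∀ i k, Measurable[𝓕 k] (d i k))
    (hd_sub : ∀ i k ω, d i k ω ∈ subdiff (f i) (x i k ω))
    (hupdate : ∀ i k ω,
      x i (k + 1) ω = x i k ω
        + α k • (∑ j, A (θ k ω) i j • (x j k ω - x i k ω))
        - β k • d i k ω)
    -- the network average
    (y : ℕ → Ω → EuclideanSpace ℝ (Fin n))
    (hy : ∀ k ω, y k ω = ((N : ℝ))⁻¹ • ∑ i, x i k ω) :
    ∀ᵐ ω ∂ℙ, ∀ i : Fin N,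
      Summable fun k => β k * ‖y k ω - x i k ω‖ := by
  have hN0 : (N : ℝ) ≠ 0 := by positivity
  have : NeZero N := ⟨by omega⟩
  set z : ℕ → Ω → EuclideanSpace ℝ (Fin n) := fun k ω => (N : ℝ)⁻¹ • ∑ i, d i k ω with hz
  set e : ℕ → Ω → Fin N → EuclideanSpace ℝ (Fin n) := fun k ω i => x i k ω - y k ω with he
  set b : ℕ → Ω → Fin N → EuclideanSpace ℝ (Fin n) := fun k ω i => d i k ω - z k ω with hb
  have hd : ∀ i k ω, ‖d i k ω‖ ≤ l := fun i k ω => hsub_bd i _ _ (hd_sub i k ω)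
  have hz_le : ∀ k ω, ‖z k ω‖ ≤ l := by
    intro k ω
    rw [hz, norm_smul, norm_inv, Real.norm_natCast, inv_mul_le_iff₀ (by positivity)]
    refine (norm_sum_le_of_le _ fun i _ => hd i k ω).trans_eq ?_
    simp
  have hb_le : ∀ k ω, ∑ i, ‖b k ω i‖ ^ 2 ≤ N * (2 * l) ^ 2 := by
    intro k ω
    refine (Finset.sum_le_sum fun i _ => pow_le_pow_left₀ (norm_nonneg _)
      ((norm_sub_le _ _).trans (add_le_add (hd i k ω) (hz_le k ω))) 2).trans_eq ?_
    simp [two_mul]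
  have hsum_drift : ∀ k ω, ∑ i, ∑ j, A (θ k ω) i j • (x j k ω - x i k ω) = 0 := by
    intro k ω
    simp only [smul_sub, Finset.sum_sub_distrib, ← Finset.sum_smul, hA_row, one_smul]
    rw [Finset.sum_comm]
    simp only [← Finset.sum_smul, hA_col, one_smul, sub_self]
  have hy_step : ∀ k ω, y (k + 1) ω = y k ω - β k • z k ω := by
    intro k ω
    simp only [hy, hupdate, Finset.sum_sub_distrib, Finset.sum_add_distrib, ← Finset.smul_sum,
      hsum_drift, smul_zero, add_zero, hz]
    rw [smul_sub, smul_comm]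
  have hstep : ∀ k ω i, e (k + 1) ω i
      = e k ω i + α k • consensusDrift (A (θ k ω)) (e k ω) i - β k • b k ω i := by
    intro k ω i
    simp only [he, hb, consensusDrift, hupdate, hy_step, sub_sub_sub_cancel_right, smul_sub (β k)]
    abel
  have hmean : ∀ k ω, ∑ i, e k ω i = 0 := by
    intro k ω
    simp only [he, Finset.sum_sub_distrib, hy]
    simp [← Nat.cast_smul_eq_nsmul ℝ, smul_smul, hN0]
  have he0 : ∃ c, ∀ ω, e 0 ω = c := by
    choose c hc using hx0
    refine ⟨fun i => c i - (N : ℝ)⁻¹ • ∑ j, c j, fun ω => funext fun i => ?_⟩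
    simp only [he, hy, hc]
  have hz_meas : ∀ k, Measurable[𝓕 k] (z k) := fun k =>
    (Finset.measurable_fun_sum _ fun i _ => hd_meas i k).const_smul (N : ℝ)⁻¹
  have hα0 : ∀ k, 0 < α k := fun k => by rw [hα]; positivity
  have hβα : Summable fun k => β k ^ 2 / α k := by
    simp only [hα, hβ]
    exact summable_step_sq_div_step (by linarith)
  have key := ae_summable_mul_disagreement (μ := ℙ) hP_nonneg hP_irr hθ_adapt hθ_markov
    hA_nonneg hA_row hA_col hconn hα0
    (fun k => by rw [hα, hα]; exact const_div_add_one_rpow_succ_le ha₁.le hδ₁0.le k)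
    (by simpa only [← hα] using tendsto_const_div_add_one_rpow a₁ hδ₁0)
    (by simpa only [← hα] using tendsto_step_relative_decrease ha₁ hδ₁0.le (by linarith))
    hβα hb_le (fun k i => (hd_meas i k).sub (hz_meas k)) he0 hmean hstep
  filter_upwards [key] with ω hω i
  have hβ0 : ∀ k, 0 ≤ β k := fun k => by rw [hβ]; positivity
  refine Summable.of_nonneg_of_le (fun k => mul_nonneg (hβ0 k) (norm_nonneg _)) (fun k => ?_)
    (hω.add hβα)
  rw [norm_sub_rev]
  have h1 : ‖e k ω i‖ ^ 2 ≤ ∑ j, ‖e k ω j‖ ^ 2 :=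
    Finset.single_le_sum (f := fun j => ‖e k ω j‖ ^ 2) (fun j _ => sq_nonneg _)
      (Finset.mem_univ i)
  have h2 := mul_le_mul_of_nonneg_left h1 (hα0 k).le
  have h3 : β k * ‖e k ω i‖ ≤ α k * ‖e k ω i‖ ^ 2 + β k ^ 2 / α k := by
    have h4 : α k * ‖e k ω i‖ ^ 2 + β k ^ 2 / α k - 2 * (β k * ‖e k ω i‖)
        = (α k * ‖e k ω i‖ - β k) ^ 2 / α k := by
      have := (hα0 k).ne'
      field_simp
      ring
    have h5 : 0 ≤ (α k * ‖e k ω i‖ - β k) ^ 2 / α k := div_nonneg (sq_nonneg _) (hα0 k).le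
    have h6 := mul_nonneg (hβ0 k) (norm_nonneg (e k ω i))
    linarith
  exact h3.trans (by linarith)
end

section
/- For every constant c₁ > 0, the weighted partial sums of exponentially discounted step sizes vanish: lim_{k→∞} Σ_{s=0}^{k} β_s · exp(−c₁ Σ_{i=s+1}^{k+1} α_i) = 0. -/
open Filter

/-- A discrete Gronwall-type criterion: a nonnegative sequence contracted by `exp (-x k)` at each
step, with a perturbation negligible compared to `x k`, vanishes when `∑ x k` diverges. -/
theorem tendsto_zero_of_le_exp_neg_mul_add (u x b : ℕ → ℝ) (hu : ∀ k, 0 ≤ u k)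
    (hrec : ∀ k, u (k + 1) ≤ Real.exp (-x k) * (u k + b k))
    (hx : Tendsto (fun n => ∑ i ∈ Finset.range n, x i) atTop atTop)
    (hb : ∀ ε > 0, ∀ᶠ k in atTop, b k ≤ ε * x k) :
    Tendsto u atTop (nhds 0) := by
  have key : ∀ ε > 0, ∀ᶠ k in atTop, u k ≤ 2 * ε := by
    intro ε hε
    obtain ⟨N, hN⟩ := eventually_atTop.1 (hb ε hε)
    have hcontr : ∀ k ≥ N, u (k + 1) - ε ≤ Real.exp (-x k) * (u k - ε) := by
      intro k hk
      have h1 : Real.exp (-x k) * (1 + x k) ≤ 1 := by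
        rw [Real.exp_neg, inv_mul_le_iff₀ (Real.exp_pos _)]
        linarith [Real.add_one_le_exp (x k)]
      have h2 := mul_le_mul_of_nonneg_left (hN k hk) (Real.exp_pos (-x k)).le
      nlinarith [hrec k]
    have hbound : ∀ k ≥ N, u k - ε ≤
        Real.exp (∑ i ∈ Finset.range N, x i - ∑ i ∈ Finset.range k, x i) * (u N - ε) := by
      intro k hk
      induction k, hk using Nat.le_induction with
      | base => simp
      | succ k hk ih =>
        refine (hcontr k hk).trans ((mul_le_mul_of_nonneg_left ih (Real.exp_pos _).le).trans ?_)
        rw [← mul_assoc, ← Real.exp_add, Finset.sum_range_succ]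
        apply le_of_eq
        ring_nf
    have hlim : Tendsto (fun k =>
        Real.exp (∑ i ∈ Finset.range N, x i - ∑ i ∈ Finset.range k, x i) * (u N - ε))
        atTop (nhds 0) := by
      have h := Real.tendsto_exp_atBot.comp (tendsto_atBot_add_const_left atTop
        (∑ i ∈ Finset.range N, x i) (tendsto_neg_atTop_atBot.comp hx))
      simpa [Function.comp_def, sub_eq_add_neg] using h.mul_const (u N - ε)
    filter_upwards [hlim.eventually_lt_const hε, eventually_ge_atTop N] with k h1 h2
    linarith [hbound k h2]
  rw [Metric.tendsto_nhds]
  intro ε hε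
  filter_upwards [key (ε / 4) (by positivity)] with k hk
  rw [Real.dist_eq, sub_zero, abs_of_nonneg (hu k)]
  linarith

theorem tendsto_sum_range_div_rpow_atTop (a δ : ℝ) (m : ℕ) (ha : 0 < a) (hδ : δ ≤ 1) :
    Tendsto (fun n => ∑ i ∈ Finset.range n, a / ((i + m : ℕ) : ℝ) ^ δ) atTop atTop := by
  rw [← not_summable_iff_tendsto_nat_atTop_of_nonneg (fun i => by positivity),
    summable_nat_add_iff (f := fun i : ℕ => a / (i : ℝ) ^ δ) m]
  simp_rw [div_eq_mul_inv]
  rw [summable_mul_left_iff ha.ne', Real.summable_nat_rpow_inv]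
  exact not_lt.2 hδ

theorem eventually_div_rpow_le_mul_div_rpow (a b δ₁ δ₂ : ℝ) (ha : 0 < a) (hb : 0 < b)
    (hδ₁ : 0 < δ₁) (hδ : δ₁ < δ₂) (ε : ℝ) (hε : 0 < ε) :
    ∀ᶠ k : ℕ in atTop, b / ((k : ℝ) + 2) ^ δ₂ ≤ ε * (a / ((k : ℝ) + 3) ^ δ₁) := by
  have hlim : Tendsto (fun k : ℕ => ((k : ℝ) + 2) ^ (δ₂ - δ₁)) atTop atTop :=
    (tendsto_rpow_atTop (sub_pos.2 hδ)).comp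
      (tendsto_atTop_add_const_right _ _ tendsto_natCast_atTop_atTop)
  filter_upwards [hlim.eventually_ge_atTop (b * 2 ^ δ₁ / (ε * a))] with k hk
  have hk2 : (0 : ℝ) < (k : ℝ) + 2 := by positivity
  have h3 : ((k : ℝ) + 3) ^ δ₁ ≤ 2 ^ δ₁ * ((k : ℝ) + 2) ^ δ₁ := by
    rw [← Real.mul_rpow (by norm_num) hk2.le]
    exact Real.rpow_le_rpow (by positivity) (by linarith) hδ₁.le
  have h4 : ((k : ℝ) + 2) ^ δ₂ = ((k : ℝ) + 2) ^ (δ₂ - δ₁) * ((k : ℝ) + 2) ^ δ₁ := by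
    rw [← Real.rpow_add hk2, sub_add_cancel]
  rw [div_le_iff₀ (by positivity)] at hk
  rw [← mul_div_assoc, div_le_div_iff₀ (by positivity) (by positivity), h4]
  calc b * ((k : ℝ) + 3) ^ δ₁ ≤ b * (2 ^ δ₁ * ((k : ℝ) + 2) ^ δ₁) := by gcongr
    _ = b * 2 ^ δ₁ * ((k : ℝ) + 2) ^ δ₁ := by ring
    _ ≤ ((k : ℝ) + 2) ^ (δ₂ - δ₁) * (ε * a) * ((k : ℝ) + 2) ^ δ₁ := by gcongr
    _ = _ := by ring

/-- With step sizes `α_k = a₁/(k+1)^δ₁`, `β_k = a₂/(k+1)^δ₂` where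
`a₁, a₂ > 0`, `0 < δ₁ < δ₂ ≤ 1` and `δ₂ − δ₁ ≥ 1/2`, for every `c₁ > 0`,
`lim_{k→∞} Σ_{s=0}^{k} β_s · exp(−c₁ Σ_{i=s+1}^{k+1} α_i) = 0`. -/
theorem stmt4 (a₁ a₂ δ₁ δ₂ : ℝ) (ha₁ : 0 < a₁) (ha₂ : 0 < a₂)
    (hδ₁0 : 0 < δ₁) (hδ₁₂ : δ₁ < δ₂) (hδ₂1 : δ₂ ≤ 1) (hgap : 1 / 2 ≤ δ₂ - δ₁)
    (α β : ℕ → ℝ)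
    (hα : ∀ k : ℕ, α k = a₁ / ((k : ℝ) + 1) ^ δ₁)
    (hβ : ∀ k : ℕ, β k = a₂ / ((k : ℝ) + 1) ^ δ₂)
    (c₁ : ℝ) (hc₁ : 0 < c₁) :
    Tendsto
      (fun k : ℕ => ∑ s ∈ Finset.range (k + 1),
        β s * Real.exp (-(c₁ * ∑ i ∈ Finset.Icc (s + 1) (k + 1), α i)))
      atTop (nhds 0) := by
  refine tendsto_zero_of_le_exp_neg_mul_add _ (fun k => c₁ * α (k + 2)) (fun k => β (k + 1))
    (fun k => ?_) (fun k => ?_) ?_ (fun ε hε => ?_)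
  · refine Finset.sum_nonneg fun s _ => mul_nonneg ?_ (Real.exp_pos _).le
    rw [hβ]
    positivity
  · have hexp : ∀ s ∈ Finset.range (k + 2),
        β s * Real.exp (-(c₁ * ∑ i ∈ Finset.Icc (s + 1) (k + 2), α i)) =
          Real.exp (-(c₁ * α (k + 2))) *
            (β s * Real.exp (-(c₁ * ∑ i ∈ Finset.Icc (s + 1) (k + 1), α i))) := by
      intro s hs
      rw [Finset.mem_range] at hs
      rw [Finset.sum_Icc_succ_top (by omega), mul_add, neg_add, Real.exp_add]
      ring
    rw [Finset.sum_congr rfl hexp, ← Finset.mul_sum, Finset.sum_range_succ]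
    simp
  · refine (tendsto_sum_range_div_rpow_atTop (c₁ * a₁) δ₁ 3 (by positivity)
      (by linarith)).congr fun n => Finset.sum_congr rfl fun i _ => ?_
    rw [hα, mul_div_assoc]
    push_cast
    ring_nf
  · filter_upwards [eventually_div_rpow_le_mul_div_rpow (c₁ * a₁) a₂ δ₁ δ₂ (by positivity) ha₂
      hδ₁0 hδ₁₂ ε hε] with k hk
    rw [hα, hβ, ← mul_div_assoc c₁]
    push_cast
    convert hk using 3 <;> ring_nf
end

section
/- For every constant c₁ > 0, the series Σ_{k=0}^{∞} β_{k+1} · exp(−c₁ Σ_{i=0}^{k+1} α_i) converges (is finite). -/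
/-- For nonnegative `u`, the series `∑ u k * exp (-(c * ∑ i ≤ k, u i))` converges, by comparison
with the telescoping differences of `exp (-(c * ∑ i < k, u i))`. -/
theorem summable_mul_exp_neg_mul_sum_range_succ {u : ℕ → ℝ} (hu : ∀ k, 0 ≤ u k) {c : ℝ}
    (hc : 0 < c) :
    Summable fun k : ℕ => u k * Real.exp (-(c * ∑ i ∈ Finset.range (k + 1), u i)) := by
  have key : ∀ k : ℕ, u k * Real.exp (-(c * ∑ i ∈ Finset.range (k + 1), u i)) ≤
      c⁻¹ * (Real.exp (-(c * ∑ i ∈ Finset.range k, u i)) -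
        Real.exp (-(c * ∑ i ∈ Finset.range (k + 1), u i))) := by
    intro k
    have h : Real.exp (-(c * ∑ i ∈ Finset.range k, u i)) =
        Real.exp (c * u k) * Real.exp (-(c * ∑ i ∈ Finset.range (k + 1), u i)) := by
      rw [← Real.exp_add, Finset.sum_range_succ]
      ring_nf
    rw [h, le_inv_mul_iff₀ hc]
    nlinarith [Real.add_one_le_exp (c * u k),
      Real.exp_pos (-(c * ∑ i ∈ Finset.range (k + 1), u i))]
  refine summable_of_sum_range_le (c := c⁻¹)
    (fun k => mul_nonneg (hu k) (Real.exp_pos _).le) fun n => ?_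
  refine (Finset.sum_le_sum fun k _ => key k).trans ?_
  rw [← Finset.mul_sum,
    Finset.sum_range_sub' (fun k => Real.exp (-(c * ∑ i ∈ Finset.range k, u i)))]
  refine mul_le_of_le_one_right (inv_nonneg.2 hc.le) ?_
  simp [(Real.exp_pos _).le]


/-- With step sizes `α_k = a₁/(k+1)^δ₁`, `β_k = a₂/(k+1)^δ₂` where
`a₁, a₂ > 0`, `0 < δ₁ < δ₂ ≤ 1` and `δ₂ − δ₁ ≥ 1/2`, for every `c₁ > 0` the series
`Σ_{k=0}^{∞} β_{k+1} · exp(−c₁ Σ_{i=0}^{k+1} α_i)` converges. -/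
theorem stmt5 (a₁ a₂ δ₁ δ₂ : ℝ) (ha₁ : 0 < a₁) (ha₂ : 0 < a₂)
    (hδ₁0 : 0 < δ₁) (hδ₁₂ : δ₁ < δ₂) (hδ₂1 : δ₂ ≤ 1) (hgap : 1 / 2 ≤ δ₂ - δ₁)
    (α β : ℕ → ℝ)
    (hα : ∀ k : ℕ, α k = a₁ / ((k : ℝ) + 1) ^ δ₁)
    (hβ : ∀ k : ℕ, β k = a₂ / ((k : ℝ) + 1) ^ δ₂)
    (c₁ : ℝ) (hc₁ : 0 < c₁) :
    Summable fun k : ℕ =>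
      β (k + 1) * Real.exp (-(c₁ * ∑ i ∈ Finset.range (k + 2), α i)) := by
  have hα0 : ∀ k, 0 ≤ α k := fun k => by rw [hα]; positivity
  have hβα : ∀ k, β k ≤ a₂ / a₁ * α k := fun k => by
    have h : a₂ / a₁ * α k = a₂ / ((k : ℝ) + 1) ^ δ₁ := by
      rw [hα]
      field_simp
    rw [h, hβ]
    gcongr
    linarith [k.cast_nonneg (α := ℝ)]
  have hs := (summable_nat_add_iff 1).2
    ((summable_mul_exp_neg_mul_sum_range_succ hα0 hc₁).mul_left (a₂ / a₁))
  refine Summable.of_nonneg_of_le (fun k => ?_) (fun k => ?_) hs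
  · rw [hβ]
    positivity
  · rw [← mul_assoc]
    exact mul_le_mul_of_nonneg_right (hβα (k + 1)) (Real.exp_pos _).le
end

section
/- For every constant c₁ > 0, the double series Σ_{k=0}^{∞} β_{k+1} · ( Σ_{s=0}^{k} β_s · exp(−c₁ Σ_{i=s+1}^{k+1} α_i) ) converges (is finite). -/
/-- A nonnegative sequence dominated by the decrements of a nonnegative sequence plus a summable
nonnegative sequence is summable. -/
theorem summable_of_le_sub_succ_add {f v g : ℕ → ℝ} (hf : ∀ k, 0 ≤ f k) (hv : ∀ k, 0 ≤ v k)
    (hg : ∀ k, 0 ≤ g k) (hgs : Summable g) (h : ∀ k, f k ≤ v k - v (k + 1) + g k) :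
    Summable f := by
  refine summable_of_sum_range_le (c := v 0 + ∑' k, g k) hf fun n => ?_
  calc ∑ k ∈ Finset.range n, f k
      ≤ ∑ k ∈ Finset.range n, (v k - v (k + 1) + g k) := Finset.sum_le_sum fun k _ => h k
    _ = v 0 - v n + ∑ k ∈ Finset.range n, g k := by
      rw [Finset.sum_add_distrib, Finset.sum_range_sub']
    _ ≤ v 0 + ∑' k, g k := by
      linarith [hv n, hgs.sum_le_tsum (Finset.range n) fun k _ => hg k]

/-- The exponentially discounted sum `∑ s ≤ k, β s * exp (-c * ∑ i ∈ [s+1, k+1], α i)` satisfies a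
one-step linear recursion. -/
theorem discounted_sum_succ (α β : ℕ → ℝ) (c : ℝ) (k : ℕ) :
    ∑ s ∈ Finset.range (k + 1 + 1),
        β s * Real.exp (-(c * ∑ i ∈ Finset.Icc (s + 1) (k + 1 + 1), α i)) =
      Real.exp (-(c * α (k + 2))) *
        (∑ s ∈ Finset.range (k + 1),
          β s * Real.exp (-(c * ∑ i ∈ Finset.Icc (s + 1) (k + 1), α i)) + β (k + 1)) := by
  rw [Finset.sum_range_succ _ (k + 1), mul_add]
  congr 1
  · rw [Finset.mul_sum]
    refine Finset.sum_congr rfl fun s hs => ?_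
    have hs' : s + 1 ≤ k + 1 + 1 := by
      have := Finset.mem_range.1 hs
      omega
    rw [Finset.sum_Icc_succ_top hs', mul_add, neg_add, Real.exp_add]
    ring
  · simp [mul_comm]

/-- With step sizes `α_k = a₁/(k+1)^δ₁`, `β_k = a₂/(k+1)^δ₂` where
`a₁, a₂ > 0`, `0 < δ₁ < δ₂ ≤ 1` and `δ₂ − δ₁ ≥ 1/2`, for every `c₁ > 0` the double series
`Σ_{k=0}^{∞} β_{k+1} · ( Σ_{s=0}^{k} β_s · exp(−c₁ Σ_{i=s+1}^{k+1} α_i) )` converges. -/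
theorem stmt6 (a₁ a₂ δ₁ δ₂ : ℝ) (ha₁ : 0 < a₁) (ha₂ : 0 < a₂)
    (hδ₁0 : 0 < δ₁) (hδ₁₂ : δ₁ < δ₂) (hδ₂1 : δ₂ ≤ 1) (hgap : 1 / 2 ≤ δ₂ - δ₁)
    (α β : ℕ → ℝ)
    (hα : ∀ k : ℕ, α k = a₁ / ((k : ℝ) + 1) ^ δ₁)
    (hβ : ∀ k : ℕ, β k = a₂ / ((k : ℝ) + 1) ^ δ₂)
    (c₁ : ℝ) (hc₁ : 0 < c₁) :
    Summable fun k : ℕ =>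
      β (k + 1) * ∑ s ∈ Finset.range (k + 1),
        β s * Real.exp (-(c₁ * ∑ i ∈ Finset.Icc (s + 1) (k + 1), α i)) := by
  have hβ0 : ∀ k, 0 ≤ β k := fun k => by rw [hβ]; positivity
  set S : ℕ → ℝ := fun k => ∑ s ∈ Finset.range (k + 1),
    β s * Real.exp (-(c₁ * ∑ i ∈ Finset.Icc (s + 1) (k + 1), α i))
  have hS0 : ∀ k, 0 ≤ S k := fun k =>
    Finset.sum_nonneg fun s _ => mul_nonneg (hβ0 s) (Real.exp_pos _).le
  have hrec : ∀ k, (1 + c₁ * α (k + 2)) * S (k + 1) ≤ S k + β (k + 1) := fun k => by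
    have hnn : 0 ≤ S k + β (k + 1) := add_nonneg (hS0 k) (hβ0 _)
    have hexp : (1 + c₁ * α (k + 2)) * Real.exp (-(c₁ * α (k + 2))) ≤ 1 := by
      rw [Real.exp_neg, ← div_eq_mul_inv, div_le_one (Real.exp_pos _), add_comm]
      exact Real.add_one_le_exp _
    have hstep : S (k + 1) = Real.exp (-(c₁ * α (k + 2))) * (S k + β (k + 1)) :=
      discounted_sum_succ α β c₁ k
    rw [hstep, ← mul_assoc]
    exact mul_le_of_le_one_left hnn hexp
  let w : ℕ → ℝ := fun k => ((k : ℝ) + 3) ^ (δ₁ - δ₂)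
  have hw0 : ∀ k, 0 ≤ w k := fun k => by positivity
  have hw : ∀ k, w (k + 1) ≤ w k := fun k =>
    Real.rpow_le_rpow_of_nonpos (by positivity) (by push_cast; linarith) (by linarith)
  have hwα : ∀ k, w k * α (k + 2) = a₁ / a₂ * β (k + 2) := fun k => by
    have h3 : ((k + 2 : ℕ) : ℝ) + 1 = (k : ℝ) + 3 := by push_cast; ring
    have hpos : (0 : ℝ) < (k : ℝ) + 3 := by positivity
    simp only [w]
    rw [hα, hβ, h3, Real.rpow_sub hpos]
    field_simp
  have hg : Summable fun k => w k * β (k + 1) := by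
    have hp : Summable fun n : ℕ => a₂ * (((n + 2 : ℕ) : ℝ) ^ (δ₁ - 2 * δ₂)) :=
      ((summable_nat_add_iff 2).2 (Real.summable_nat_rpow.2 (by linarith))).mul_left a₂
    refine hp.of_nonneg_of_le (fun k => mul_nonneg (hw0 k) (hβ0 _)) fun k => ?_
    have h2 : ((k + 1 : ℕ) : ℝ) + 1 = (k : ℝ) + 2 := by push_cast; ring
    have hpos : (0 : ℝ) < (k : ℝ) + 2 := by positivity
    have hle : w k ≤ ((k : ℝ) + 2) ^ (δ₁ - δ₂) :=
      Real.rpow_le_rpow_of_nonpos hpos (by linarith) (by linarith)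
    calc w k * β (k + 1) ≤ ((k : ℝ) + 2) ^ (δ₁ - δ₂) * β (k + 1) :=
          mul_le_mul_of_nonneg_right hle (hβ0 _)
      _ = a₂ * (((k + 2 : ℕ) : ℝ) ^ (δ₁ - 2 * δ₂)) := by
          rw [hβ, h2, show δ₁ - 2 * δ₂ = (δ₁ - δ₂) - δ₂ by ring]
          push_cast
          rw [Real.rpow_sub hpos (δ₁ - δ₂) δ₂]
          ring
  have hC : 0 < c₁ * (a₁ / a₂) := by positivity
  have key : Summable fun k => c₁ * (a₁ / a₂) * (β (k + 2) * S (k + 1)) := by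
    refine summable_of_le_sub_succ_add (v := fun k => w k * S k) (g := fun k => w k * β (k + 1))
      (fun k => mul_nonneg hC.le (mul_nonneg (hβ0 _) (hS0 _)))
      (fun k => mul_nonneg (hw0 k) (hS0 k)) (fun k => mul_nonneg (hw0 k) (hβ0 _)) hg fun k => ?_
    have h1 := mul_le_mul_of_nonneg_left (hrec k) (hw0 k)
    have h2 := mul_le_mul_of_nonneg_right (hw k) (hS0 (k + 1))
    have h3 : w k * ((1 + c₁ * α (k + 2)) * S (k + 1)) =
        w k * S (k + 1) + c₁ * (a₁ / a₂) * (β (k + 2) * S (k + 1)) := by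
      linear_combination c₁ * S (k + 1) * hwα k
    linarith
  exact (summable_nat_add_iff 1).1 ((summable_mul_left_iff hC.ne').1 key)
end
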